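/- In the resolvent-sequence setting, if (H2) or (H3) holds, then for every ε with 0 < ε < β/12: ∫_{2ε}^{β−2ε} |v¹ₙ′|² dx → 0 and λₙ² ∫_{3ε}^{β−3ε} |v¹ₙ|² dx → 0 as n → ∞. -/

import Mathlib

open Set Filter MeasureTheory

noncomputable section

/-- The resolvent-sequence setting for the locally damped Bresse system with
parameter `ℓ`: a sequence of nonzero frequencies `lam n` with `|lam n| → ∞`,
solutions `Uₙ = (v1,…,v6)` and right-hand sides `Fₙ = (f1,…,f6)` of the resolvent
equations `(lam n)^ℓ (i (lam n) I − 𝒜) Uₙ = Fₙ`, with `‖Uₙ‖_H = 1` and `‖Fₙ‖_H → 0`. -/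
structure BresseSetting (ρ₁ ρ₂ k₁ k₂ k₃ l L β a₀ : ℝ) (ℓ : ℕ) where
  lam : ℕ → ℝ
  v1 : ℕ → ℝ → ℂ
  v2 : ℕ → ℝ → ℂ
  v3 : ℕ → ℝ → ℂ
  v4 : ℕ → ℝ → ℂ
  v5 : ℕ → ℝ → ℂ
  v6 : ℕ → ℝ → ℂ
  f1 : ℕ → ℝ → ℂ
  f2 : ℕ → ℝ → ℂ
  f3 : ℕ → ℝ → ℂ
  f4 : ℕ → ℝ → ℂ
  f5 : ℕ → ℝ → ℂ
  f6 : ℕ → ℝ → ℂ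
  lam_ne : ∀ n, lam n ≠ 0
  lam_tendsto : Tendsto (fun n => |lam n|) atTop atTop
  reg_v1 : ∀ n, ContDiffOn ℝ 2 (v1 n) (Icc 0 L)
  reg_v3 : ∀ n, ContDiffOn ℝ 2 (v3 n) (Icc 0 L)
  reg_v5 : ∀ n, ContDiffOn ℝ 1 (v5 n) (Icc 0 L)
  reg_v5_left : ∀ n, ContDiffOn ℝ 2 (v5 n) (Icc 0 β)
  reg_v5_right : ∀ n, ContDiffOn ℝ 2 (v5 n) (Icc β L)
  reg_v2 : ∀ n, ContDiffOn ℝ 1 (v2 n) (Icc 0 L)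
  reg_v4 : ∀ n, ContDiffOn ℝ 1 (v4 n) (Icc 0 L)
  reg_v6 : ∀ n, ContDiffOn ℝ 1 (v6 n) (Icc 0 L)
  reg_f1 : ∀ n, ContDiffOn ℝ 1 (f1 n) (Icc 0 L)
  reg_f3 : ∀ n, ContDiffOn ℝ 1 (f3 n) (Icc 0 L)
  reg_f5 : ∀ n, ContDiffOn ℝ 1 (f5 n) (Icc 0 L)
  reg_f2 : ∀ n, ContinuousOn (f2 n) (Icc 0 L)
  reg_f4 : ∀ n, ContinuousOn (f4 n) (Icc 0 L)
  reg_f6 : ∀ n, ContinuousOn (f6 n) (Icc 0 L)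
  bc_zero : ∀ n, v1 n 0 = 0 ∧ v2 n 0 = 0 ∧ v3 n 0 = 0 ∧ v4 n 0 = 0 ∧ v5 n 0 = 0 ∧
      v6 n 0 = 0 ∧ f1 n 0 = 0 ∧ f3 n 0 = 0 ∧ f5 n 0 = 0
  bc_L : ∀ n, v1 n L = 0 ∧ v2 n L = 0 ∧ v3 n L = 0 ∧ v4 n L = 0 ∧ v5 n L = 0 ∧
      v6 n L = 0 ∧ f1 n L = 0 ∧ f3 n L = 0 ∧ f5 n L = 0
  eq1 : ∀ n, ∀ x ∈ Ioo (0 : ℝ) β ∪ Ioo β L,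
      Complex.I * (lam n : ℂ) * v1 n x - v2 n x = (lam n : ℂ) ^ (-(ℓ : ℤ)) * f1 n x
  eq2 : ∀ n, ∀ x ∈ Ioo (0 : ℝ) β ∪ Ioo β L,
      Complex.I * (lam n : ℂ) * (ρ₁ : ℂ) * v2 n x
        - (k₁ : ℂ) * deriv (fun y => deriv (v1 n) y + v3 n y + (l : ℂ) * v5 n y) x
        - (l : ℂ) * (k₃ : ℂ) * (deriv (v5 n) x - (l : ℂ) * v1 n x)
        = (ρ₁ : ℂ) * (lam n : ℂ) ^ (-(ℓ : ℤ)) * f2 n x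
  eq3 : ∀ n, ∀ x ∈ Ioo (0 : ℝ) β ∪ Ioo β L,
      Complex.I * (lam n : ℂ) * v3 n x - v4 n x = (lam n : ℂ) ^ (-(ℓ : ℤ)) * f3 n x
  eq4 : ∀ n, ∀ x ∈ Ioo (0 : ℝ) β ∪ Ioo β L,
      Complex.I * (lam n : ℂ) * (ρ₂ : ℂ) * v4 n x
        - (k₂ : ℂ) * deriv (deriv (v3 n)) x
        + (k₁ : ℂ) * (deriv (v1 n) x + v3 n x + (l : ℂ) * v5 n x)
        = (ρ₂ : ℂ) * (lam n : ℂ) ^ (-(ℓ : ℤ)) * f4 n x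
  eq5 : ∀ n, ∀ x ∈ Ioo (0 : ℝ) β ∪ Ioo β L,
      Complex.I * (lam n : ℂ) * v5 n x - v6 n x = (lam n : ℂ) ^ (-(ℓ : ℤ)) * f5 n x
  eq6 : ∀ n, ∀ x ∈ Ioo (0 : ℝ) β ∪ Ioo β L,
      Complex.I * (lam n : ℂ) * (ρ₁ : ℂ) * v6 n x
        - (k₃ : ℂ) * deriv (fun y => deriv (v5 n) y - (l : ℂ) * v1 n y) x
        + (l : ℂ) * (k₁ : ℂ) * (deriv (v1 n) x + v3 n x + (l : ℂ) * v5 n x)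
        + (if x < β then (a₀ : ℂ) else 0) * v6 n x
        = (ρ₁ : ℂ) * (lam n : ℂ) ^ (-(ℓ : ℤ)) * f6 n x
  normU : ∀ n, (∫ x in (0 : ℝ)..L,
      (k₁ * ‖deriv (v1 n) x + v3 n x + (l : ℂ) * v5 n x‖ ^ 2 + ρ₁ * ‖v2 n x‖ ^ 2
        + k₂ * ‖deriv (v3 n) x‖ ^ 2 + ρ₂ * ‖v4 n x‖ ^ 2
        + k₃ * ‖deriv (v5 n) x - (l : ℂ) * v1 n x‖ ^ 2 + ρ₁ * ‖v6 n x‖ ^ 2)) = 1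
  normF : Tendsto (fun n => ∫ x in (0 : ℝ)..L,
      (k₁ * ‖deriv (f1 n) x + f3 n x + (l : ℂ) * f5 n x‖ ^ 2 + ρ₁ * ‖f2 n x‖ ^ 2
        + k₂ * ‖deriv (f3 n) x‖ ^ 2 + ρ₂ * ‖f4 n x‖ ^ 2
        + k₃ * ‖deriv (f5 n) x - (l : ℂ) * f1 n x‖ ^ 2 + ρ₁ * ‖f6 n x‖ ^ 2))
      atTop (nhds 0)

/-- Square-integral smallness of a sequence of continuous functions. -/
def Sm (a b : ℝ) (g : ℕ → ℝ → ℂ) : Prop :=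
  (∀ n, ContinuousOn (g n) (Icc a b)) ∧
    Tendsto (fun n => ∫ x in a..b, ‖g n x‖ ^ 2) atTop (nhds 0)

/-- Square-integral boundedness of a sequence of continuous functions. -/
def Bd (a b : ℝ) (g : ℕ → ℝ → ℂ) : Prop :=
  (∀ n, ContinuousOn (g n) (Icc a b)) ∧
    ∃ C : ℝ, ∀ᶠ n in atTop, ∫ x in a..b, ‖g n x‖ ^ 2 ≤ C

lemma ii_of_cont {E : Type*} [NormedAddCommGroup E] {a b : ℝ} (hab : a ≤ b) {g : ℝ → E}
    (h : ContinuousOn g (Icc a b)) : IntervalIntegrable g volume a b := by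
  apply ContinuousOn.intervalIntegrable
  rwa [uIcc_of_le hab]

lemma ii_sq {a b : ℝ} (hab : a ≤ b) {g : ℝ → ℂ} (h : ContinuousOn g (Icc a b)) :
    IntervalIntegrable (fun x => ‖g x‖ ^ 2) volume a b :=
  ii_of_cont hab (h.norm.pow 2)

lemma int_nonneg {a b : ℝ} (hab : a ≤ b) (g : ℝ → ℂ) : 0 ≤ ∫ x in a..b, ‖g x‖ ^ 2 :=
  intervalIntegral.integral_nonneg hab (fun _ _ => by positivity)

lemma Sm.bd {a b : ℝ} {g : ℕ → ℝ → ℂ} (h : Sm a b g) : Bd a b g :=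
  ⟨h.1, 1, (h.2.eventually (gt_mem_nhds one_pos)).mono fun _ hn => le_of_lt hn⟩

lemma int_add_le {a b : ℝ} (hab : a ≤ b) {f g : ℝ → ℂ} (hf : ContinuousOn f (Icc a b))
    (hg : ContinuousOn g (Icc a b)) :
    ∫ x in a..b, ‖f x + g x‖ ^ 2 ≤
      2 * (∫ x in a..b, ‖f x‖ ^ 2) + 2 * ∫ x in a..b, ‖g x‖ ^ 2 := by
  have i1 := ii_sq hab hf
  have i2 := ii_sq hab hg
  have i3 : IntervalIntegrable (fun x => ‖f x + g x‖ ^ 2) volume a b := ii_sq hab (hf.add hg)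
  rw [← intervalIntegral.integral_const_mul, ← intervalIntegral.integral_const_mul,
    ← intervalIntegral.integral_add (i1.const_mul 2) (i2.const_mul 2)]
  apply intervalIntegral.integral_mono_on hab i3 ((i1.const_mul 2).add (i2.const_mul 2))
  intro x _
  have := norm_add_le (f x) (g x)
  have h0 := norm_nonneg (f x + g x)
  nlinarith [sq_nonneg (‖f x‖ - ‖g x‖)]

lemma Sm.add {a b : ℝ} (hab : a ≤ b) {f g : ℕ → ℝ → ℂ} (hf : Sm a b f) (hg : Sm a b g) :
    Sm a b (fun n x => f n x + g n x) := by
  refine ⟨fun n => (hf.1 n).add (hg.1 n), ?_⟩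
  have := (hf.2.const_mul 2).add (hg.2.const_mul 2)
  simp only [mul_zero, add_zero] at this
  exact squeeze_zero (fun n => int_nonneg hab _) (fun n => int_add_le hab (hf.1 n) (hg.1 n)) this

lemma Bd.add {a b : ℝ} (hab : a ≤ b) {f g : ℕ → ℝ → ℂ} (hf : Bd a b f) (hg : Bd a b g) :
    Bd a b (fun n x => f n x + g n x) := by
  refine ⟨fun n => (hf.1 n).add (hg.1 n), ?_⟩
  obtain ⟨C, hC⟩ := hf.2
  obtain ⟨D, hD⟩ := hg.2
  refine ⟨2 * C + 2 * D, ?_⟩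
  filter_upwards [hC, hD] with n h1 h2
  have := int_add_le hab (hf.1 n) (hg.1 n)
  linarith

lemma int_smul {a b : ℝ} (c : ℂ) (f : ℝ → ℂ) :
    ∫ x in a..b, ‖c * f x‖ ^ 2 = ‖c‖ ^ 2 * ∫ x in a..b, ‖f x‖ ^ 2 := by
  rw [← intervalIntegral.integral_const_mul]
  congr 1
  ext x
  rw [norm_mul, mul_pow]

/-- bounded scalar times small -/
lemma Sm.smul {a b : ℝ} (hab : a ≤ b) {f : ℕ → ℝ → ℂ} (hf : Sm a b f) {c : ℕ → ℂ} {K : ℝ}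
    (hc : ∀ᶠ n in atTop, ‖c n‖ ≤ K) : Sm a b (fun n x => c n * f n x) := by
  refine ⟨fun n => continuousOn_const.mul (hf.1 n), ?_⟩
  have := hf.2.const_mul (K ^ 2)
  rw [mul_zero] at this
  refine squeeze_zero' (Eventually.of_forall fun n => int_nonneg hab _) ?_ this
  filter_upwards [hc] with n hn
  rw [int_smul]
  exact mul_le_mul_of_nonneg_right (pow_le_pow_left₀ (norm_nonneg _) hn 2) (int_nonneg hab _)

lemma Sm.cmul {a b : ℝ} (hab : a ≤ b) {f : ℕ → ℝ → ℂ} (hf : Sm a b f) (c : ℂ) :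
    Sm a b (fun n x => c * f n x) :=
  hf.smul hab (c := fun _ => c) (Eventually.of_forall fun _ => le_refl ‖c‖)

lemma Bd.smul {a b : ℝ} (hab : a ≤ b) {f : ℕ → ℝ → ℂ} (hf : Bd a b f) {c : ℕ → ℂ} {K : ℝ}
    (hc : ∀ᶠ n in atTop, ‖c n‖ ≤ K) : Bd a b (fun n x => c n * f n x) := by
  refine ⟨fun n => continuousOn_const.mul (hf.1 n), ?_⟩
  obtain ⟨C, hC⟩ := hf.2
  refine ⟨K ^ 2 * C, ?_⟩
  filter_upwards [hC, hc] with n h1 hn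
  rw [int_smul]
  exact mul_le_mul (pow_le_pow_left₀ (norm_nonneg _) hn 2) h1 (int_nonneg hab _) (by positivity)

lemma Bd.cmul {a b : ℝ} (hab : a ≤ b) {f : ℕ → ℝ → ℂ} (hf : Bd a b f) (c : ℂ) :
    Bd a b (fun n x => c * f n x) :=
  hf.smul hab (c := fun _ => c) (Eventually.of_forall fun _ => le_refl ‖c‖)

/-- vanishing scalar times bounded -/
lemma Bd.smul_zero {a b : ℝ} (hab : a ≤ b) {f : ℕ → ℝ → ℂ} (hf : Bd a b f) {c : ℕ → ℂ}
    (hc : Tendsto (fun n => ‖c n‖) atTop (nhds 0)) : Sm a b (fun n x => c n * f n x) := by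
  refine ⟨fun n => continuousOn_const.mul (hf.1 n), ?_⟩
  obtain ⟨C, hC⟩ := hf.2
  have := (hc.pow 2).mul_const C
  rw [zero_pow two_ne_zero, zero_mul] at this
  refine squeeze_zero' (Eventually.of_forall fun n => int_nonneg hab _) ?_ this
  filter_upwards [hC] with n h1
  rw [int_smul]
  exact mul_le_mul_of_nonneg_left h1 (by positivity)

lemma int_mono {a b p q : ℝ} (hap : a ≤ p) (hpq : p ≤ q) (hqb : q ≤ b) {f : ℝ → ℂ}
    (hf : ContinuousOn f (Icc a b)) :
    ∫ x in p..q, ‖f x‖ ^ 2 ≤ ∫ x in a..b, ‖f x‖ ^ 2 := by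
  apply intervalIntegral.integral_mono_interval hap hpq hqb
  · exact Eventually.of_forall fun x => by positivity
  · exact ii_of_cont (hap.trans (hpq.trans hqb)) (hf.norm.pow 2)

lemma Sm.mono {a b p q : ℝ} (hap : a ≤ p) (hpq : p ≤ q) (hqb : q ≤ b) {f : ℕ → ℝ → ℂ}
    (hf : Sm a b f) : Sm p q f :=
  ⟨fun n => (hf.1 n).mono (Icc_subset_Icc hap hqb),
    squeeze_zero (fun n => int_nonneg hpq _) (fun n => int_mono hap hpq hqb (hf.1 n)) hf.2⟩

lemma Bd.mono {a b p q : ℝ} (hap : a ≤ p) (hpq : p ≤ q) (hqb : q ≤ b) {f : ℕ → ℝ → ℂ}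
    (hf : Bd a b f) : Bd p q f := by
  obtain ⟨C, hC⟩ := hf.2
  refine ⟨fun n => (hf.1 n).mono (Icc_subset_Icc hap hqb), C, ?_⟩
  filter_upwards [hC] with n hn
  exact (int_mono hap hpq hqb (hf.1 n)).trans hn

lemma Sm.congr {a b : ℝ} (hab : a ≤ b) {f g : ℕ → ℝ → ℂ} (hf : Sm a b f)
    (h : ∀ n, ∀ x ∈ Icc a b, g n x = f n x) : Sm a b g := by
  refine ⟨fun n => (hf.1 n).congr (h n), hf.2.congr fun n => ?_⟩
  apply intervalIntegral.integral_congr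
  intro x hx
  rw [uIcc_of_le hab] at hx
  simp only [h n x hx]

lemma Bd.congr {a b : ℝ} (hab : a ≤ b) {f g : ℕ → ℝ → ℂ} (hf : Bd a b f)
    (h : ∀ n, ∀ x ∈ Icc a b, g n x = f n x) : Bd a b g := by
  obtain ⟨C, hC⟩ := hf.2
  refine ⟨fun n => (hf.1 n).congr (h n), C, ?_⟩
  filter_upwards [hC] with n hn
  refine le_of_eq_of_le ?_ hn
  apply intervalIntegral.integral_congr
  intro x hx
  rw [uIcc_of_le hab] at hx
  simp only [h n x hx]

lemma tendsto_zero_of_s {u K : ℕ → ℝ} {C : ℝ} (h0 : ∀ n, 0 ≤ u n)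
    (hK : Tendsto K atTop (nhds 0))
    (h : ∀ s : ℝ, 0 < s → ∀ᶠ n in atTop, u n ≤ s * C + K n / s) :
    Tendsto u atTop (nhds 0) := by
  have hC : 0 < |C| + 1 := by positivity
  rw [Metric.tendsto_atTop']
  intro e he
  have hs : 0 < e / (2 * (|C| + 1)) := by positivity
  set s := e / (2 * (|C| + 1)) with hsd
  have h1 : ∀ᶠ n in atTop, K n < s * (e / 2) := hK.eventually (gt_mem_nhds (by positivity))
  obtain ⟨N, hN⟩ := eventually_atTop.1 (h1.and (h s hs))
  refine ⟨N, fun n hn => ?_⟩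
  obtain ⟨h2, h3⟩ := hN n hn.le
  rw [Real.dist_eq, sub_zero, abs_of_nonneg (h0 n)]
  have h4 : K n / s < e / 2 := by rw [div_lt_iff₀ hs]; linarith
  have h5 : s * C ≤ e / 2 := by
    calc s * C ≤ s * (|C| + 1) := by
          apply mul_le_mul_of_nonneg_left _ hs.le
          linarith [le_abs_self C]
      _ = e / 2 := by rw [hsd]; field_simp
  linarith

lemma abs_re_mul_conj_le (z w : ℂ) : |(z * (starRingEnd ℂ) w).re| ≤ ‖z‖ * ‖w‖ := by
  refine (Complex.abs_re_le_norm _).trans ?_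
  rw [norm_mul, RCLike.norm_conj]

lemma mul_le_s {s : ℝ} (hs : 0 < s) (x y : ℝ) : x * y ≤ s * x ^ 2 + y ^ 2 / s := by
  have : s * x ^ 2 + y ^ 2 / s = (s * x - y) ^ 2 / s + 2 * (x * y) := by
    field_simp
    ring
  have h2 : s * x ^ 2 + y ^ 2 / s ≥ 0 := by positivity
  have h3 : (s * x - y) ^ 2 / s ≥ 0 := by positivity
  nlinarith

lemma cont_pair {a b : ℝ} {φ : ℝ → ℝ} (hφ : ContinuousOn φ (Icc a b)) {f g : ℝ → ℂ}
    (hf : ContinuousOn f (Icc a b)) (hg : ContinuousOn g (Icc a b)) :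
    ContinuousOn (fun x => φ x * (f x * (starRingEnd ℂ) (g x)).re) (Icc a b) :=
  hφ.mul (Complex.continuous_re.comp_continuousOn
    (hf.mul (Complex.continuous_conj.comp_continuousOn hg)))

lemma pair {a b : ℝ} (hab : a ≤ b) {φ : ℝ → ℝ} (hφ : ContinuousOn φ (Icc a b))
    {f g : ℕ → ℝ → ℂ} (hf : Bd a b f) (hg : Sm a b g) :
    Tendsto (fun n => ∫ x in a..b, φ x * (f n x * (starRingEnd ℂ) (g n x)).re)
      atTop (nhds 0) := by
  obtain ⟨C, hC⟩ := hf.2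
  obtain ⟨M, hM⟩ := isCompact_Icc.exists_bound_of_continuousOn hφ
  rw [tendsto_zero_iff_abs_tendsto_zero]
  have hM0 : 0 ≤ M := (norm_nonneg _).trans (hM a ⟨le_refl _, hab⟩)
  have hK := hg.2.const_mul M
  rw [mul_zero] at hK
  refine tendsto_zero_of_s (C := M * C) (fun n => abs_nonneg _) hK fun s hs => ?_
  filter_upwards [hC] with n hn
  have i1 := ii_sq hab (hf.1 n)
  have i2 := ii_sq hab (hg.1 n)
  have hle : |∫ x in a..b, φ x * (f n x * (starRingEnd ℂ) (g n x)).re| ≤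
      ∫ x in a..b, (M * s) * ‖f n x‖ ^ 2 + (M / s) * ‖g n x‖ ^ 2 := by
    refine (intervalIntegral.abs_integral_le_integral_abs hab).trans ?_
    refine intervalIntegral.integral_mono_on hab
      (ii_of_cont hab (cont_pair hφ (hf.1 n) (hg.1 n))).abs
      ((i1.const_mul _).add (i2.const_mul _)) fun x hx => ?_
    rw [abs_mul]
    have h1 := abs_re_mul_conj_le (f n x) (g n x)
    have h2 := mul_le_s hs ‖f n x‖ ‖g n x‖
    have h3 := hM x hx
    rw [Real.norm_eq_abs] at h3
    calc |φ x| * |(f n x * (starRingEnd ℂ) (g n x)).re| ≤ M * (s * ‖f n x‖ ^ 2 + ‖g n x‖ ^ 2 / s) :=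
          mul_le_mul h3 (h1.trans h2) (abs_nonneg _) hM0
      _ = _ := by ring
  refine hle.trans ?_
  rw [intervalIntegral.integral_add (i1.const_mul _) (i2.const_mul _)]
  simp only [intervalIntegral.integral_const_mul]
  have : M * s * ∫ x in a..b, ‖f n x‖ ^ 2 ≤ M * s * C :=
    mul_le_mul_of_nonneg_left hn (by positivity)
  calc _ ≤ M * s * C + M / s * ∫ x in a..b, ‖g n x‖ ^ 2 := by linarith
    _ = _ := by ring

lemma pair' {a b : ℝ} (hab : a ≤ b) {φ : ℝ → ℝ} (hφ : ContinuousOn φ (Icc a b))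
    {f g : ℕ → ℝ → ℂ} (hf : Bd a b f) (hg : Sm a b g) :
    Tendsto (fun n => ∫ x in a..b, φ x * (g n x * (starRingEnd ℂ) (f n x)).re)
      atTop (nhds 0) := by
  refine (pair hab hφ hf hg).congr fun n => ?_
  congr 1
  ext x
  simp only [Complex.mul_re, Complex.conj_re, Complex.conj_im]
  ring

/-- cutoff -/
def eta (p q x : ℝ) : ℝ := ((x - p) * (q - x)) ^ 2
/-- derivative of the cutoff -/
def eta' (p q x : ℝ) : ℝ := 2 * ((x - p) * (q - x)) * ((q - x) - (x - p))

lemma eta_cont (p q : ℝ) : Continuous (eta p q) := by unfold eta; fun_prop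
lemma eta'_cont (p q : ℝ) : Continuous (eta' p q) := by unfold eta'; fun_prop
lemma eta_deriv (p q x : ℝ) : HasDerivAt (eta p q) (eta' p q x) x := by
  have h1 : HasDerivAt (fun x => x - p) 1 x := (hasDerivAt_id x).sub_const p
  have h2 : HasDerivAt (fun x => q - x) (-1) x := (hasDerivAt_id x).const_sub q
  have := (h1.mul h2).pow 2
  refine this.congr_deriv ?_
  simp only [eta', Pi.mul_apply]
  push_cast
  ring

lemma hasDerivAt_conj {w : ℝ → ℂ} {w' : ℂ} {x : ℝ} (h : HasDerivAt w w' x) :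
    HasDerivAt (fun y => (starRingEnd ℂ) (w y)) ((starRingEnd ℂ) w') x :=
  (Complex.conjCLE.toContinuousLinearMap.hasFDerivAt.comp_hasDerivAt x h)

lemma hasDerivAt_re {w : ℝ → ℂ} {w' : ℂ} {x : ℝ} (h : HasDerivAt w w' x) :
    HasDerivAt (fun y => (w y).re) w'.re x :=
  (Complex.reCLM.hasFDerivAt.comp_hasDerivAt x h)

lemma ibp {p q : ℝ} (hpq : p ≤ q) {u u' w w' : ℝ → ℂ}
    (hu : ∀ x ∈ Icc p q, HasDerivAt u (u' x) x) (hw : ∀ x ∈ Icc p q, HasDerivAt w (w' x) x)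
    (hu' : ContinuousOn u' (Icc p q)) (hw' : ContinuousOn w' (Icc p q)) :
    (∫ x in p..q, eta p q x * (u' x * (starRingEnd ℂ) (w x)).re)
      + (∫ x in p..q, eta p q x * (u x * (starRingEnd ℂ) (w' x)).re)
      + (∫ x in p..q, eta' p q x * (u x * (starRingEnd ℂ) (w x)).re) = 0 := by
  have cu : ContinuousOn u (Icc p q) := fun x hx => (hu x hx).continuousAt.continuousWithinAt
  have cw : ContinuousOn w (Icc p q) := fun x hx => (hw x hx).continuousAt.continuousWithinAt
  have ce := (eta_cont p q).continuousOn (s := Icc p q)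
  have ce' := (eta'_cont p q).continuousOn (s := Icc p q)
  have i1 := ii_of_cont hpq (cont_pair ce hu' cw)
  have i2 := ii_of_cont hpq (cont_pair ce cu hw')
  have i3 := ii_of_cont hpq (cont_pair ce' cu cw)
  rw [← intervalIntegral.integral_add i1 i2, ← intervalIntegral.integral_add (i1.add i2) i3]
  have key := intervalIntegral.integral_eq_sub_of_hasDerivAt
    (f := fun x => eta p q x * (u x * (starRingEnd ℂ) (w x)).re)
    (f' := fun x => eta p q x * (u' x * (starRingEnd ℂ) (w x)).re
      + eta p q x * (u x * (starRingEnd ℂ) (w' x)).re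
      + eta' p q x * (u x * (starRingEnd ℂ) (w x)).re) (a := p) (b := q) ?_ ((i1.add i2).add i3)
  · refine Eq.trans key ?_
    simp [eta]
  · intro x hx
    rw [uIcc_of_le hpq] at hx
    refine ((eta_deriv p q x).mul
      (hasDerivAt_re ((hu x hx).mul (hasDerivAt_conj (hw x hx))))).congr_deriv ?_
    simp only [Complex.add_re, Pi.mul_apply]
    ring

lemma key_ibp {p q : ℝ} (hpq : p ≤ q) {u u' w w' : ℕ → ℝ → ℂ}
    (hu : ∀ n, ∀ x ∈ Icc p q, HasDerivAt (u n) (u' n x) x)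
    (hw : ∀ n, ∀ x ∈ Icc p q, HasDerivAt (w n) (w' n x) x)
    (hu' : ∀ n, ContinuousOn (u' n) (Icc p q)) (hw' : ∀ n, ContinuousOn (w' n) (Icc p q))
    (hub : Bd p q u) (hws : Sm p q w) :
    Tendsto (fun n => (∫ x in p..q, eta p q x * (u' n x * (starRingEnd ℂ) (w n x)).re)
      + ∫ x in p..q, eta p q x * (u n x * (starRingEnd ℂ) (w' n x)).re) atTop (nhds 0) := by
  have := (pair hpq (eta'_cont p q).continuousOn hub hws).neg
  rw [neg_zero] at this
  refine this.congr fun n => ?_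
  linarith [ibp hpq (hu n) (hw n) (hu' n) (hw' n)]

/-- localisation -/
lemma loc {p q e : ℝ} (he : 0 < e) (hpq : p + e ≤ q - e) {g : ℕ → ℝ → ℂ}
    (hc : ∀ n, ContinuousOn (g n) (Icc p q))
    (h : Tendsto (fun n => ∫ x in p..q, eta p q x * (g n x * (starRingEnd ℂ) (g n x)).re)
      atTop (nhds 0)) : Sm (p + e) (q - e) g := by
  have hpq' : p ≤ q := by linarith
  refine ⟨fun n => (hc n).mono (Icc_subset_Icc (by linarith) (by linarith)), ?_⟩
  have h2 := h.const_mul ((e ^ 4)⁻¹)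
  rw [mul_zero] at h2
  refine squeeze_zero (fun n => int_nonneg hpq _) (fun n => ?_) h2
  have hi := ii_of_cont hpq' (cont_pair (eta_cont p q).continuousOn (hc n) (hc n))
  have hz : ∀ z : ℂ, (z * (starRingEnd ℂ) z).re = ‖z‖ ^ 2 := fun z => by
    rw [Complex.mul_conj, Complex.ofReal_re, Complex.normSq_eq_norm_sq]
  rw [← intervalIntegral.integral_const_mul]
  have hi2 := hi.const_mul (e ^ 4)⁻¹
  have m1 : ∫ x in (p + e)..(q - e),
      (e ^ 4)⁻¹ * (eta p q x * (g n x * (starRingEnd ℂ) (g n x)).re) ≤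
      ∫ x in p..q, (e ^ 4)⁻¹ * (eta p q x * (g n x * (starRingEnd ℂ) (g n x)).re) := by
    apply intervalIntegral.integral_mono_interval (by linarith) hpq (by linarith) _ hi2
    refine Eventually.of_forall fun x => ?_
    simp only [hz, eta, Pi.zero_apply]
    positivity
  refine le_trans ?_ m1
  have hs : Icc (p + e) (q - e) ⊆ Icc p q := Icc_subset_Icc (by linarith) (by linarith)
  apply intervalIntegral.integral_mono_on hpq
  · exact ii_of_cont hpq (((hc n).mono hs).norm.pow 2)
  · refine hi2.mono_set ?_
    rw [uIcc_of_le hpq, uIcc_of_le hpq']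
    exact hs
  · intro x hx
    rw [hz]
    have h1 : e ≤ x - p := by linarith [hx.1]
    have h2 : e ≤ q - x := by linarith [hx.2]
    have h3 : e ^ 2 ≤ (x - p) * (q - x) := by nlinarith
    have h4 : e ^ 4 ≤ eta p q x := by
      unfold eta
      nlinarith [sq_nonneg e]
    rw [← mul_assoc]
    have h5 : 1 ≤ (e ^ 4)⁻¹ * eta p q x := by
      rw [inv_mul_eq_div, le_div_iff₀ (by positivity)]
      linarith
    nlinarith [sq_nonneg ‖g n x‖]

/-- The energy density. -/
def dens (ρ₁ ρ₂ k₁ k₂ k₃ l : ℝ) (d1 d3 d5 g1 g2 g3 g4 g5 g6 : ℝ → ℂ) (x : ℝ) : ℝ :=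
  k₁ * ‖d1 x + g3 x + (l : ℂ) * g5 x‖ ^ 2 + ρ₁ * ‖g2 x‖ ^ 2
        + k₂ * ‖d3 x‖ ^ 2 + ρ₂ * ‖g4 x‖ ^ 2
        + k₃ * ‖d5 x - (l : ℂ) * g1 x‖ ^ 2 + ρ₁ * ‖g6 x‖ ^ 2

lemma dens_cont (ρ₁ ρ₂ k₁ k₂ k₃ l : ℝ) {d1 d3 d5 g1 g2 g3 g4 g5 g6 : ℝ → ℂ} {s : Set ℝ}
    (hd1 : ContinuousOn d1 s) (hd3 : ContinuousOn d3 s) (hd5 : ContinuousOn d5 s)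
    (h1 : ContinuousOn g1 s) (h2 : ContinuousOn g2 s) (h3 : ContinuousOn g3 s)
    (h4 : ContinuousOn g4 s) (h5 : ContinuousOn g5 s) (h6 : ContinuousOn g6 s) :
    ContinuousOn (dens ρ₁ ρ₂ k₁ k₂ k₃ l d1 d3 d5 g1 g2 g3 g4 g5 g6) s := by
  unfold dens
  fun_prop

lemma ext_deriv {f : ℝ → ℂ} {a b : ℝ} (hab : a < b) (h : ContDiffOn ℝ 1 f (Icc a b)) :
    ∃ d : ℝ → ℂ, ContinuousOn d (Icc a b) ∧ ∀ x ∈ Ioo a b, HasDerivAt f (d x) x := by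
  refine ⟨derivWithin f (Icc a b), h.continuousOn_derivWithin (uniqueDiffOn_Icc hab) le_rfl, ?_⟩
  intro x hx
  have h1 := (h.differentiableOn one_ne_zero) x (Ioo_subset_Icc_self hx)
  exact h1.hasDerivWithinAt.hasDerivAt (Icc_mem_nhds hx.1 hx.2)

lemma cd_deriv_one {f : ℝ → ℂ} {a b : ℝ} (h : ContDiffOn ℝ 1 f (Icc a b)) :
    ContinuousOn (deriv f) (Ioo a b) ∧ ∀ x ∈ Ioo a b, HasDerivAt f (deriv f x) x := by
  have h' := h.mono Ioo_subset_Icc_self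
  refine ⟨h'.continuousOn_deriv_of_isOpen isOpen_Ioo le_rfl, fun x hx => ?_⟩
  exact ((h'.differentiableOn one_ne_zero).differentiableAt (isOpen_Ioo.mem_nhds hx)).hasDerivAt

lemma cd_deriv_two {f : ℝ → ℂ} {a b : ℝ} (h : ContDiffOn ℝ 2 f (Icc a b)) :
    ContinuousOn (deriv (deriv f)) (Ioo a b) ∧
      ∀ x ∈ Ioo a b, HasDerivAt (deriv f) (deriv (deriv f) x) x := by
  have h' := h.mono Ioo_subset_Icc_self
  have h2 : ContDiffOn ℝ 1 (deriv f) (Ioo a b) := by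
    refine ((contDiffOn_succ_iff_deriv_of_isOpen (n := 1) isOpen_Ioo).1 ?_).2.2
    simpa [one_add_one_eq_two] using h'
  refine ⟨h2.continuousOn_deriv_of_isOpen isOpen_Ioo le_rfl, fun x hx => ?_⟩
  exact ((h2.differentiableOn one_ne_zero).differentiableAt (isOpen_Ioo.mem_nhds hx)).hasDerivAt

lemma int_congr_Ioo {f g : ℝ → ℝ} {a b : ℝ} (hab : a ≤ b) (h : ∀ x ∈ Ioo a b, f x = g x) :
    ∫ x in a..b, f x = ∫ x in a..b, g x := by
  rw [intervalIntegral.integral_of_le hab, intervalIntegral.integral_of_le hab,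
    integral_Ioc_eq_integral_Ioo, integral_Ioc_eq_integral_Ioo]
  exact setIntegral_congr_fun measurableSet_Ioo h

/-- The right hand side of the energy identity. -/
def rhs (ρ₁ ρ₂ k₁ k₂ k₃ l : ℝ) (d1 d3 d5 v1 v2 v3 v4 v5 v6 e1 e3 e5 f1 f2 f3 f4 f5 f6 : ℝ → ℂ)
    (x : ℝ) : ℝ :=
  k₁ * ((d1 x + v3 x + (l : ℂ) * v5 x) * (starRingEnd ℂ) (e1 x + f3 x + (l : ℂ) * f5 x)).re
  + ρ₁ * (f2 x * (starRingEnd ℂ) (v2 x)).re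
  + k₂ * (d3 x * (starRingEnd ℂ) (e3 x)).re
  + ρ₂ * (f4 x * (starRingEnd ℂ) (v4 x)).re
  + k₃ * ((d5 x - (l : ℂ) * v1 x) * (starRingEnd ℂ) (e5 x - (l : ℂ) * f1 x)).re
  + ρ₁ * (f6 x * (starRingEnd ℂ) (v6 x)).re

lemma ftc_real {a b : ℝ} (hab : a ≤ b) {g g' : ℝ → ℝ} (hg : ContinuousOn g (Icc a b))
    (hd : ∀ x ∈ Ioo a b, HasDerivAt g (g' x) x) (hg' : ContinuousOn g' (Icc a b)) :
    ∫ x in a..b, g' x = g b - g a :=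
  intervalIntegral.integral_eq_sub_of_hasDerivAt_of_le hab hg hd (ii_of_cont hab hg')

lemma energy_pt (ρ₁ ρ₂ k₁ k₂ k₃ l lam c a : ℝ) 
    (d1 d3 d5 v1 v2 v3 v4 v5 v6 e1 e3 e5 f1 f2 f3 f4 f5 f6 t1 t3 t5 : ℂ)
    (eq1 : Complex.I * (lam : ℂ) * v1 - v2 = c * f1)
    (eq2 : Complex.I * (lam : ℂ) * (ρ₁ : ℂ) * v2 - (k₁ : ℂ) * t1
        - (l : ℂ) * (k₃ : ℂ) * (d5 - (l : ℂ) * v1) = (ρ₁ : ℂ) * c * f2)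
    (eq3 : Complex.I * (lam : ℂ) * v3 - v4 = c * f3)
    (eq4 : Complex.I * (lam : ℂ) * (ρ₂ : ℂ) * v4 - (k₂ : ℂ) * t3
        + (k₁ : ℂ) * (d1 + v3 + (l : ℂ) * v5) = (ρ₂ : ℂ) * c * f4)
    (eq5 : Complex.I * (lam : ℂ) * v5 - v6 = c * f5)
    (eq6 : Complex.I * (lam : ℂ) * (ρ₁ : ℂ) * v6 - (k₃ : ℂ) * t5
        + (l : ℂ) * (k₁ : ℂ) * (d1 + v3 + (l : ℂ) * v5) + a * v6 = (ρ₁ : ℂ) * c * f6) :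
    (k₁ * (t1 * (starRingEnd ℂ) v2 + (d1 + v3 + (l : ℂ) * v5) *
        (starRingEnd ℂ) (Complex.I * lam * d1 - c * e1))
      + k₂ * (t3 * (starRingEnd ℂ) v4 + d3 * (starRingEnd ℂ) (Complex.I * lam * d3 - c * e3))
      + k₃ * (t5 * (starRingEnd ℂ) v6 + (d5 - (l : ℂ) * v1) *
        (starRingEnd ℂ) (Complex.I * lam * d5 - c * e5))).re =
    a * ‖v6‖ ^ 2 - c * (k₁ * ((d1 + v3 + (l : ℂ) * v5) *
        (starRingEnd ℂ) (e1 + f3 + (l : ℂ) * f5)).re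
      + ρ₁ * (f2 * (starRingEnd ℂ) (v2)).re
      + k₂ * (d3 * (starRingEnd ℂ) (e3)).re
      + ρ₂ * (f4 * (starRingEnd ℂ) (v4)).re
      + k₃ * ((d5 - (l : ℂ) * v1) * (starRingEnd ℂ) (e5 - (l : ℂ) * f1)).re
      + ρ₁ * (f6 * (starRingEnd ℂ) (v6)).re) := by
  have c1 : -Complex.I * lam * (starRingEnd ℂ) v1 - (starRingEnd ℂ) v2
      = c * (starRingEnd ℂ) f1 := by simpa using congrArg (starRingEnd ℂ) eq1
  have c3 : -Complex.I * lam * (starRingEnd ℂ) v3 - (starRingEnd ℂ) v4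
      = c * (starRingEnd ℂ) f3 := by simpa using congrArg (starRingEnd ℂ) eq3
  have c5 : -Complex.I * lam * (starRingEnd ℂ) v5 - (starRingEnd ℂ) v6
      = c * (starRingEnd ℂ) f5 := by simpa using congrArg (starRingEnd ℂ) eq5
  have hG : k₁ * (t1 * (starRingEnd ℂ) v2 + (d1 + v3 + (l : ℂ) * v5) *
        (starRingEnd ℂ) (Complex.I * lam * d1 - c * e1))
      + k₂ * (t3 * (starRingEnd ℂ) v4 + d3 * (starRingEnd ℂ) (Complex.I * lam * d3 - c * e3))
      + k₃ * (t5 * (starRingEnd ℂ) v6 + (d5 - (l : ℂ) * v1) *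
        (starRingEnd ℂ) (Complex.I * lam * d5 - c * e5))
      = a * (v6 * (starRingEnd ℂ) v6)
      - c * (k₁ * ((d1 + v3 + (l : ℂ) * v5) * (starRingEnd ℂ) (e1 + f3 + (l : ℂ) * f5))
      + ρ₁ * (f2 * (starRingEnd ℂ) (v2))
      + k₂ * (d3 * (starRingEnd ℂ) (e3))
      + ρ₂ * (f4 * (starRingEnd ℂ) (v4))
      + k₃ * ((d5 - (l : ℂ) * v1) * (starRingEnd ℂ) (e5 - (l : ℂ) * f1))
      + ρ₁ * (f6 * (starRingEnd ℂ) (v6)))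
      + (lam * (ρ₁ * (v2 * (starRingEnd ℂ) v2) + ρ₂ * (v4 * (starRingEnd ℂ) v4)
        + ρ₁ * (v6 * (starRingEnd ℂ) v6)
        - k₁ * ((d1 + v3 + (l : ℂ) * v5) * (starRingEnd ℂ) (d1 + v3 + (l : ℂ) * v5))
        - k₂ * (d3 * (starRingEnd ℂ) d3)
        - k₃ * ((d5 - (l : ℂ) * v1) * (starRingEnd ℂ) (d5 - (l : ℂ) * v1)))) * Complex.I := by
    simp only [map_add, map_sub, map_mul, Complex.conj_ofReal, Complex.conj_I]
    linear_combination (-(starRingEnd ℂ) v2) * eq2 - (starRingEnd ℂ) v4 * eq4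
      - (starRingEnd ℂ) v6 * eq6
      + (l * k₃ * (d5 - l * v1)) * c1 - (k₁ * (d1 + v3 + l * v5)) * c3
      - (l * k₁ * (d1 + v3 + l * v5)) * c5
  rw [hG]
  simp only [Complex.mul_conj]
  simp only [← Complex.ofReal_mul, ← Complex.ofReal_add, ← Complex.ofReal_sub, Complex.add_re, Complex.sub_re,
    Complex.re_ofReal_mul, Complex.ofReal_re, Complex.I_re, mul_zero,
    add_zero, Complex.normSq_eq_norm_sq]

lemma energy {ρ₁ ρ₂ k₁ k₂ k₃ l lam c a₀ β L : ℝ} (hbeta : 0 < β) (hbetaL : β < L)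
    {d1 d3 d5 v1 v2 v3 v4 v5 v6 e1 e3 e5 f1 f2 f3 f4 f5 f6 t1 t3 t5 : ℝ → ℂ}
    (cd1 : ContinuousOn d1 (Icc 0 L)) (cd3 : ContinuousOn d3 (Icc 0 L))
    (cd5 : ContinuousOn d5 (Icc 0 L))
    (cv1 : ContinuousOn v1 (Icc 0 L)) (cv2 : ContinuousOn v2 (Icc 0 L))
    (cv3 : ContinuousOn v3 (Icc 0 L)) (cv4 : ContinuousOn v4 (Icc 0 L))
    (cv5 : ContinuousOn v5 (Icc 0 L)) (cv6 : ContinuousOn v6 (Icc 0 L))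
    (ce1 : ContinuousOn e1 (Icc 0 L)) (ce3 : ContinuousOn e3 (Icc 0 L))
    (ce5 : ContinuousOn e5 (Icc 0 L))
    (cf1 : ContinuousOn f1 (Icc 0 L)) (cf2 : ContinuousOn f2 (Icc 0 L))
    (cf3 : ContinuousOn f3 (Icc 0 L)) (cf4 : ContinuousOn f4 (Icc 0 L))
    (cf5 : ContinuousOn f5 (Icc 0 L)) (cf6 : ContinuousOn f6 (Icc 0 L))
    (h20 : v2 0 = 0) (h40 : v4 0 = 0) (h60 : v6 0 = 0)
    (h2L : v2 L = 0) (h4L : v4 L = 0) (h6L : v6 L = 0)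
    (hT : ∀ x ∈ Ioo 0 β ∪ Ioo β L, HasDerivAt (fun y => d1 y + v3 y + (l : ℂ) * v5 y) (t1 x) x)
    (h3 : ∀ x ∈ Ioo 0 β ∪ Ioo β L, HasDerivAt d3 (t3 x) x)
    (hN : ∀ x ∈ Ioo 0 β ∪ Ioo β L, HasDerivAt (fun y => d5 y - (l : ℂ) * v1 y) (t5 x) x)
    (hv2 : ∀ x ∈ Ioo 0 β ∪ Ioo β L, HasDerivAt v2 (Complex.I * lam * d1 x - c * e1 x) x)
    (hv4 : ∀ x ∈ Ioo 0 β ∪ Ioo β L, HasDerivAt v4 (Complex.I * lam * d3 x - c * e3 x) x)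
    (hv6 : ∀ x ∈ Ioo 0 β ∪ Ioo β L, HasDerivAt v6 (Complex.I * lam * d5 x - c * e5 x) x)
    (eq1 : ∀ x ∈ Ioo 0 β ∪ Ioo β L, Complex.I * (lam : ℂ) * v1 x - v2 x = c * f1 x)
    (eq2 : ∀ x ∈ Ioo 0 β ∪ Ioo β L, Complex.I * (lam : ℂ) * (ρ₁ : ℂ) * v2 x - (k₁ : ℂ) * t1 x
        - (l : ℂ) * (k₃ : ℂ) * (d5 x - (l : ℂ) * v1 x) = (ρ₁ : ℂ) * c * f2 x)
    (eq3 : ∀ x ∈ Ioo 0 β ∪ Ioo β L, Complex.I * (lam : ℂ) * v3 x - v4 x = c * f3 x)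
    (eq4 : ∀ x ∈ Ioo 0 β ∪ Ioo β L, Complex.I * (lam : ℂ) * (ρ₂ : ℂ) * v4 x - (k₂ : ℂ) * t3 x
        + (k₁ : ℂ) * (d1 x + v3 x + (l : ℂ) * v5 x) = (ρ₂ : ℂ) * c * f4 x)
    (eq5 : ∀ x ∈ Ioo 0 β ∪ Ioo β L, Complex.I * (lam : ℂ) * v5 x - v6 x = c * f5 x)
    (eq6 : ∀ x ∈ Ioo 0 β ∪ Ioo β L, Complex.I * (lam : ℂ) * (ρ₁ : ℂ) * v6 x - (k₃ : ℂ) * t5 x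
        + (l : ℂ) * (k₁ : ℂ) * (d1 x + v3 x + (l : ℂ) * v5 x)
        + (if x < β then (a₀ : ℂ) else 0) * v6 x = (ρ₁ : ℂ) * c * f6 x) :
    a₀ * ∫ x in (0 : ℝ)..β, ‖v6 x‖ ^ 2 = c * ∫ x in (0 : ℝ)..L,
      rhs ρ₁ ρ₂ k₁ k₂ k₃ l d1 d3 d5 v1 v2 v3 v4 v5 v6 e1 e3 e5 f1 f2 f3 f4 f5 f6 x := by
  set R := rhs ρ₁ ρ₂ k₁ k₂ k₃ l d1 d3 d5 v1 v2 v3 v4 v5 v6 e1 e3 e5 f1 f2 f3 f4 f5 f6 with hR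
  have hconj : Continuous (starRingEnd ℂ) := Complex.continuous_conj
  have cR : ContinuousOn R (Icc 0 L) := by
    have hre : ∀ {f g : ℝ → ℂ}, ContinuousOn f (Icc 0 L) → ContinuousOn g (Icc 0 L) →
      ContinuousOn (fun x => (f x * (starRingEnd ℂ) (g x)).re) (Icc 0 L) := fun hf hg =>
        Complex.continuous_re.comp_continuousOn (hf.mul (hconj.comp_continuousOn hg))
    have q1 := hre ((cd1.add cv3).add (continuousOn_const.mul cv5) (f := fun x => d1 x + v3 x) (g := fun x => (l:ℂ) * v5 x))
      ((ce1.add cf3).add (continuousOn_const.mul cf5) (f := fun x => e1 x + f3 x) (g := fun x => (l:ℂ) * f5 x))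
    have q2 := hre cf2 cv2
    have q3 := hre cd3 ce3
    have q4 := hre cf4 cv4
    have q5 := hre (cd5.sub (continuousOn_const.mul cv1) (g := fun x => (l:ℂ) * v1 x))
      (ce5.sub (continuousOn_const.mul cf1) (g := fun x => (l:ℂ) * f1 x))
    have q6 := hre cf6 cv6
    exact (((((q1.const_mul k₁).add (q2.const_mul ρ₁)).add (q3.const_mul k₂)).add
      (q4.const_mul ρ₂)).add (q5.const_mul k₃)).add (q6.const_mul ρ₁)
  set G : ℝ → ℝ := fun x => (k₁ * ((d1 x + v3 x + (l : ℂ) * v5 x) * (starRingEnd ℂ) (v2 x))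
      + k₂ * (d3 x * (starRingEnd ℂ) (v4 x))
      + k₃ * ((d5 x - (l : ℂ) * v1 x) * (starRingEnd ℂ) (v6 x))).re with hG
  have cG : ContinuousOn G (Icc 0 L) := by
    have w2 := hconj.comp_continuousOn cv2
    have w4 := hconj.comp_continuousOn cv4
    have w6 := hconj.comp_continuousOn cv6
    simp only [Function.comp_def] at w2 w4 w6
    apply Complex.continuous_re.comp_continuousOn
    fun_prop
  have hGd : ∀ x ∈ Ioo 0 β ∪ Ioo β L,
      HasDerivAt G ((if x < β then a₀ else 0) * ‖v6 x‖ ^ 2 - c * R x) x := by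
    intro x hx
    have e1' := energy_pt ρ₁ ρ₂ k₁ k₂ k₃ l lam c (if x < β then a₀ else 0) (d1 x) (d3 x) (d5 x)
      (v1 x) (v2 x) (v3 x) (v4 x) (v5 x) (v6 x) (e1 x) (e3 x) (e5 x)
      (f1 x) (f2 x) (f3 x) (f4 x) (f5 x) (f6 x) (t1 x) (t3 x) (t5 x) (eq1 x hx) (eq2 x hx)
      (eq3 x hx) (eq4 x hx) (eq5 x hx) (by
        have := eq6 x hx
        split_ifs at this ⊢ <;> simpa using this)
    have q1 := (hT x hx).mul (hasDerivAt_conj (hv2 x hx))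
    have q2 := (h3 x hx).mul (hasDerivAt_conj (hv4 x hx))
    have q3 := (hN x hx).mul (hasDerivAt_conj (hv6 x hx))
    have q := hasDerivAt_re (((q1.const_mul (k₁ : ℂ)).add (q2.const_mul (k₂ : ℂ))).add
      (q3.const_mul (k₃ : ℂ)))
    exact q.congr_deriv e1'
  have s1 : Icc 0 β ⊆ Icc 0 L := Icc_subset_Icc le_rfl hbetaL.le
  have s2 : Icc β L ⊆ Icc 0 L := Icc_subset_Icc hbeta.le le_rfl
  have I1 := ftc_real hbeta.le (g := G) (g' := fun x => a₀ * ‖v6 x‖ ^ 2 - c * R x) (cG.mono s1)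
    (fun x hx => by
      have := hGd x (Or.inl hx)
      rwa [if_pos hx.2] at this)
    ((((cv6.mono s1).norm.pow 2).const_mul a₀).sub ((cR.mono s1).const_mul c))
  have I2 := ftc_real hbetaL.le (g := G) (g' := fun x => - (c * R x)) (cG.mono s2)
    (fun x hx => by
      have := hGd x (Or.inr hx)
      rw [if_neg (not_lt.2 hx.1.le), zero_mul, zero_sub] at this
      exact this)
    ((cR.mono s2).const_mul c).neg
  have G0 : G 0 = 0 := by simp [hG, h20, h40, h60]
  have GL : G L = 0 := by simp [hG, h2L, h4L, h6L]
  have j1 : IntervalIntegrable R volume 0 β := ii_of_cont hbeta.le (cR.mono s1)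
  have j2 : IntervalIntegrable R volume β L := ii_of_cont hbetaL.le (cR.mono s2)
  rw [intervalIntegral.integral_sub ((ii_sq hbeta.le (cv6.mono s1)).const_mul a₀)
    (j1.const_mul c)] at I1
  simp only [intervalIntegral.integral_const_mul, intervalIntegral.integral_neg] at I1 I2
  rw [← intervalIntegral.integral_add_adjacent_intervals j1 j2]
  linarith

lemma rhs_le {ρ₁ ρ₂ k₁ k₂ k₃ l : ℝ} (hrho1 : 0 < ρ₁) (hrho2 : 0 < ρ₂) (hk1 : 0 < k₁)
    (hk2 : 0 < k₂) (hk3 : 0 < k₃)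
    (d1 d3 d5 v1 v2 v3 v4 v5 v6 e1 e3 e5 f1 f2 f3 f4 f5 f6 : ℝ → ℂ) (x : ℝ) {s : ℝ}
    (hs : 0 < s) :
    |rhs ρ₁ ρ₂ k₁ k₂ k₃ l d1 d3 d5 v1 v2 v3 v4 v5 v6 e1 e3 e5 f1 f2 f3 f4 f5 f6 x| ≤
      s * dens ρ₁ ρ₂ k₁ k₂ k₃ l d1 d3 d5 v1 v2 v3 v4 v5 v6 x
        + dens ρ₁ ρ₂ k₁ k₂ k₃ l e1 e3 e5 f1 f2 f3 f4 f5 f6 x / s := by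
  have h1 : ∀ (k : ℝ) (z w : ℂ), 0 < k → |k * (z * (starRingEnd ℂ) w).re| ≤
      s * (k * ‖z‖ ^ 2) + (k * ‖w‖ ^ 2) / s := by
    intro k z w hk
    rw [abs_mul, abs_of_pos hk]
    have := mul_le_mul_of_nonneg_left
      ((abs_re_mul_conj_le z w).trans (mul_le_s hs ‖z‖ ‖w‖)) hk.le
    refine this.trans (le_of_eq ?_)
    ring
  have h2 : ∀ (k : ℝ) (z w : ℂ), 0 < k → |k * (w * (starRingEnd ℂ) z).re| ≤
      s * (k * ‖z‖ ^ 2) + (k * ‖w‖ ^ 2) / s := by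
    intro k z w hk
    have : (w * (starRingEnd ℂ) z).re = (z * (starRingEnd ℂ) w).re := by
      simp only [Complex.mul_re, Complex.conj_re, Complex.conj_im]
      ring
    rw [this]
    exact h1 k z w hk
  have a1 := h1 k₁ (d1 x + v3 x + (l : ℂ) * v5 x) (e1 x + f3 x + (l : ℂ) * f5 x) hk1
  have a2 := h2 ρ₁ (v2 x) (f2 x) hrho1
  have a3 := h1 k₂ (d3 x) (e3 x) hk2
  have a4 := h2 ρ₂ (v4 x) (f4 x) hrho2
  have a5 := h1 k₃ (d5 x - (l : ℂ) * v1 x) (e5 x - (l : ℂ) * f1 x) hk3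
  have a6 := h2 ρ₁ (v6 x) (f6 x) hrho1
  unfold rhs dens
  simp only [mul_add, add_div]
  rw [abs_le] at *
  constructor <;> linarith [a1.1, a2.1, a3.1, a4.1, a5.1, a6.1, a1.2, a2.2, a3.2, a4.2, a5.2, a6.2]

lemma dens_nonneg {ρ₁ ρ₂ k₁ k₂ k₃ l : ℝ} (hrho1 : 0 < ρ₁) (hrho2 : 0 < ρ₂) (hk1 : 0 < k₁)
    (hk2 : 0 < k₂) (hk3 : 0 < k₃) (d1 d3 d5 v1 v2 v3 v4 v5 v6 : ℝ → ℂ) (x : ℝ) :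
    0 ≤ dens ρ₁ ρ₂ k₁ k₂ k₃ l d1 d3 d5 v1 v2 v3 v4 v5 v6 x := by
  unfold dens
  positivity

lemma ii_congr_Ioo {f g : ℝ → ℝ} {a b : ℝ} (hab : a ≤ b) (h : ∀ x ∈ Ioo a b, f x = g x)
    (hf : IntervalIntegrable f volume a b) : IntervalIntegrable g volume a b := by
  rw [intervalIntegrable_iff_integrableOn_Ioo_of_le hab] at *
  exact hf.congr_fun h measurableSet_Ioo

lemma dens_ii (ρ₁ ρ₂ k₁ k₂ k₃ l : ℝ) {L : ℝ} (hL : 0 < L) {g1 g2 g3 g4 g5 g6 : ℝ → ℂ}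
    (h1 : ContDiffOn ℝ 1 g1 (Icc 0 L)) (h3 : ContDiffOn ℝ 1 g3 (Icc 0 L))
    (h5 : ContDiffOn ℝ 1 g5 (Icc 0 L)) (h2 : ContinuousOn g2 (Icc 0 L))
    (h4 : ContinuousOn g4 (Icc 0 L)) (h6 : ContinuousOn g6 (Icc 0 L)) :
    IntervalIntegrable
      (dens ρ₁ ρ₂ k₁ k₂ k₃ l (deriv g1) (deriv g3) (deriv g5) g1 g2 g3 g4 g5 g6) volume 0 L := by
  obtain ⟨d1, c1, H1⟩ := ext_deriv hL h1
  obtain ⟨d3, c3, H3⟩ := ext_deriv hL h3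
  obtain ⟨d5, c5, H5⟩ := ext_deriv hL h5
  refine ii_congr_Ioo hL.le ?_ (ii_of_cont hL.le (dens_cont ρ₁ ρ₂ k₁ k₂ k₃ l c1 c3 c5
    h1.continuousOn h2 h3.continuousOn h4 h5.continuousOn h6))
  intro x hx
  simp only [dens, (H1 x hx).deriv, (H3 x hx).deriv, (H5 x hx).deriv]

lemma poin {L : ℝ} (hL : 0 < L) {h h' : ℝ → ℂ} {D : ℝ → ℝ} (hc : ContinuousOn h (Icc 0 L))
    (hd : ∀ x ∈ Ioo 0 L, HasDerivAt h (h' x) x) (hc' : ContinuousOn h' (Icc 0 L))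
    (h0 : h 0 = 0) (hD : IntervalIntegrable D volume 0 L)
    (hle : ∀ x ∈ Ioo 0 L, ‖h' x‖ ^ 2 ≤ D x) :
    ∀ x ∈ Icc 0 L, ‖h x‖ ≤ L + ∫ x in (0 : ℝ)..L, D x := by
  intro x hx
  have hs : Icc 0 x ⊆ Icc 0 L := Icc_subset_Icc le_rfl hx.2
  have key := intervalIntegral.integral_eq_sub_of_hasDerivAt_of_le hx.1 (hc.mono hs)
    (fun y hy => hd y ⟨hy.1, hy.2.trans_le hx.2⟩) (ii_of_cont hx.1 (hc'.mono hs))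
  rw [h0, sub_zero] at key
  rw [← key]
  have i1 : IntervalIntegrable (fun y => ‖h' y‖) volume 0 L := ii_of_cont hL.le hc'.norm
  have i2 : IntervalIntegrable (fun y => 1 + D y) volume 0 L :=
    (_root_.intervalIntegrable_const).add hD
  calc ‖∫ y in (0 : ℝ)..x, h' y‖ ≤ ∫ y in (0 : ℝ)..x, ‖h' y‖ :=
        intervalIntegral.norm_integral_le_integral_norm hx.1
    _ ≤ ∫ y in (0 : ℝ)..L, ‖h' y‖ := by
        apply intervalIntegral.integral_mono_interval le_rfl hx.1 hx.2 _ i1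
        exact Eventually.of_forall fun y => norm_nonneg _
    _ ≤ ∫ y in (0 : ℝ)..L, (1 + D y) := by
        apply intervalIntegral.integral_mono_on_of_le_Ioo hL.le i1 i2
        intro y hy
        nlinarith [hle y hy, sq_nonneg (‖h' y‖ - 1), sq_nonneg (‖h' y‖)]
    _ = L + ∫ y in (0 : ℝ)..L, D y := by
        rw [intervalIntegral.integral_add _root_.intervalIntegrable_const hD]
        simp

lemma sq3 (x y z : ℂ) : ‖x + y + z‖ ^ 2 ≤ 3 * (‖x‖ ^ 2 + ‖y‖ ^ 2 + ‖z‖ ^ 2) := by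
  have h := norm_add₃_le (a := x) (b := y) (c := z)
  have h0 := norm_nonneg (x + y + z)
  have : ‖x + y + z‖ ^ 2 ≤ (‖x‖ + ‖y‖ + ‖z‖) ^ 2 := pow_le_pow_left₀ h0 h 2
  nlinarith [sq_nonneg (‖x‖ - ‖y‖), sq_nonneg (‖y‖ - ‖z‖), sq_nonneg (‖x‖ - ‖z‖)]

lemma F_sup {ρ₁ ρ₂ k₁ k₂ k₃ l L : ℝ} (hrho1 : 0 < ρ₁) (hrho2 : 0 < ρ₂) (hk1 : 0 < k₁)
    (hk2 : 0 < k₂) (hk3 : 0 < k₃) (hL : 0 < L) :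
    ∃ M : ℝ, ∀ f1 f2 f3 f4 f5 f6 : ℝ → ℂ, 
      ContDiffOn ℝ 1 f1 (Icc 0 L) → ContDiffOn ℝ 1 f3 (Icc 0 L) → ContDiffOn ℝ 1 f5 (Icc 0 L) →
      ContinuousOn f2 (Icc 0 L) → ContinuousOn f4 (Icc 0 L) → ContinuousOn f6 (Icc 0 L) →
      f1 0 = 0 → f3 0 = 0 → f5 0 = 0 →
      (∫ x in (0 : ℝ)..L, dens ρ₁ ρ₂ k₁ k₂ k₃ l (deriv f1) (deriv f3) (deriv f5)
        f1 f2 f3 f4 f5 f6 x) ≤ 1 →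
      ∀ x ∈ Icc 0 L, ‖f1 x‖ ≤ M ∧ ‖f3 x‖ ≤ M ∧ ‖f5 x‖ ≤ M := by
  set M3 : ℝ := L + k₂⁻¹ with hM3
  have hM3p : 0 < M3 := by positivity
  set Mz : ℝ := L + (3 * (k₁⁻¹ + k₃⁻¹) + 3 * M3 ^ 2 * L) with hMz
  have hMzp : 0 < Mz := by positivity
  refine ⟨M3 + Mz, ?_⟩
  intro f1 f2 f3 f4 f5 f6 r1 r3 r5 r2 r4 r6 z1 z3 z5 hE
  have hDi := dens_ii ρ₁ ρ₂ k₁ k₂ k₃ l hL r1 r3 r5 r2 r4 r6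
  have hDn : ∀ x, k₁ * ‖deriv f1 x + f3 x + l * f5 x‖ ^ 2 ≤ dens ρ₁ ρ₂ k₁ k₂ k₃ l (deriv f1) (deriv f3) (deriv f5)
        f1 f2 f3 f4 f5 f6 x ∧ k₂ * ‖deriv f3 x‖ ^ 2 ≤ dens ρ₁ ρ₂ k₁ k₂ k₃ l (deriv f1) (deriv f3) (deriv f5)
        f1 f2 f3 f4 f5 f6 x ∧ k₃ * ‖deriv f5 x - l * f1 x‖ ^ 2 ≤ dens ρ₁ ρ₂ k₁ k₂ k₃ l (deriv f1) (deriv f3) (deriv f5)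
        f1 f2 f3 f4 f5 f6 x := by
    intro x
    unfold dens
    refine ⟨?_, ?_, ?_⟩
    · have : 0 ≤ ρ₁ * ‖f2 x‖ ^ 2
        + k₂ * ‖deriv f3 x‖ ^ 2 + ρ₂ * ‖f4 x‖ ^ 2
        + k₃ * ‖deriv f5 x - (l : ℂ) * f1 x‖ ^ 2 + ρ₁ * ‖f6 x‖ ^ 2 := by positivity
      linarith
    · have : 0 ≤ k₁ * ‖deriv f1 x + f3 x + l * f5 x‖ ^ 2 + ρ₁ * ‖f2 x‖ ^ 2
        + ρ₂ * ‖f4 x‖ ^ 2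
        + k₃ * ‖deriv f5 x - (l : ℂ) * f1 x‖ ^ 2 + ρ₁ * ‖f6 x‖ ^ 2 := by positivity
      linarith
    · have : 0 ≤ k₁ * ‖deriv f1 x + f3 x + l * f5 x‖ ^ 2 + ρ₁ * ‖f2 x‖ ^ 2
        + k₂ * ‖deriv f3 x‖ ^ 2 + ρ₂ * ‖f4 x‖ ^ 2 + ρ₁ * ‖f6 x‖ ^ 2 := by positivity
      linarith
  set D := dens ρ₁ ρ₂ k₁ k₂ k₃ l (deriv f1) (deriv f3) (deriv f5) f1 f2 f3 f4 f5 f6 with hD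
  obtain ⟨d1, c1, H1⟩ := ext_deriv hL r1
  obtain ⟨d3, c3, H3⟩ := ext_deriv hL r3
  obtain ⟨d5, c5, H5⟩ := ext_deriv hL r5
  have b3 : ∀ x ∈ Icc 0 L, ‖f3 x‖ ≤ M3 := by
    intro x hx
    refine (poin hL r3.continuousOn H3 c3 z3 (hDi.const_mul k₂⁻¹) ?_ x hx).trans ?_
    · intro y hy
      rw [inv_mul_eq_div, le_div_iff₀ hk2, ← (H3 y hy).deriv]
      linarith [(hDn y).2.1]
    · rw [intervalIntegral.integral_const_mul]
      have : k₂⁻¹ * ∫ x in (0 : ℝ)..L, D x ≤ k₂⁻¹ * 1 :=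
        mul_le_mul_of_nonneg_left hE (by positivity)
      linarith
  have bz : ∀ σ : ℝ, σ ^ 2 = 1 → ∀ x ∈ Icc 0 L, ‖f1 x + σ * Complex.I * f5 x‖ ≤ Mz := by
    intro σ hσ x hx
    have hσ' : (σ : ℂ) ^ 2 = 1 := by exact_mod_cast hσ
    have hσn : ‖(σ : ℂ)‖ ^ 2 = 1 := by rw [Complex.norm_real, Real.norm_eq_abs, sq_abs, hσ]
    set h : ℝ → ℂ := fun y => Complex.exp (((-σ * l * y : ℝ) : ℂ) * Complex.I) *
      (f1 y + σ * Complex.I * f5 y) with hh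
    set h' : ℝ → ℂ := fun y => Complex.exp (((-σ * l * y : ℝ) : ℂ) * Complex.I) *
      ((d1 y + f3 y + l * f5 y) + (- f3 y) + σ * Complex.I * (d5 y - l * f1 y)) with hh'
    have nexp : ∀ y : ℝ, ‖Complex.exp (((-σ * l * y : ℝ) : ℂ) * Complex.I)‖ = 1 := fun y =>
      Complex.norm_exp_ofReal_mul_I _
    have cexp : Continuous fun y : ℝ => Complex.exp (((-σ * l * y : ℝ) : ℂ) * Complex.I) := by
      fun_prop
    have q1 := r1.continuousOn
    have q3 := r3.continuousOn
    have q5 := r5.continuousOn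
    have ch : ContinuousOn h (Icc 0 L) := cexp.continuousOn.mul (by fun_prop)
    have ch' : ContinuousOn h' (Icc 0 L) := cexp.continuousOn.mul (by fun_prop)
    have hd : ∀ y ∈ Ioo 0 L, HasDerivAt h (h' y) y := by
      intro y hy
      have p0 : HasDerivAt (fun y : ℝ => (-σ * l * y : ℝ)) (-σ * l * 1) y :=
        (hasDerivAt_id y).const_mul (-σ * l)
      have p1 := (p0.ofReal_comp.mul_const Complex.I).cexp
      have p2 := (H1 y hy).add ((H5 y hy).const_mul (σ * Complex.I : ℂ))
      refine (p1.mul p2).congr_deriv ?_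
      simp only [hh', Pi.add_apply]
      push_cast
      have hI : Complex.I ^ 2 = -1 := Complex.I_sq
      linear_combination (-Complex.exp (-σ * l * y * Complex.I) * l * f5 y * Complex.I ^ 2) * hσ'
        - (Complex.exp (-σ * l * y * Complex.I) * l * f5 y) * hI
    have hn : ‖h x‖ = ‖f1 x + σ * Complex.I * f5 x‖ := by
      simp only [hh, norm_mul, nexp, one_mul]
    rw [← hn]
    refine (poin hL ch hd ch' (by simp [hh, z1, z5])
      (D := fun y => 3 * (k₁⁻¹ + k₃⁻¹) * D y + 3 * M3 ^ 2)
      ((hDi.const_mul _).add _root_.intervalIntegrable_const) ?_ x hx).trans ?_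
    · intro y hy
      have n1 : ‖h' y‖ ^ 2 = ‖(d1 y + f3 y + l * f5 y) + (- f3 y)
          + σ * Complex.I * (d5 y - l * f1 y)‖ ^ 2 := by
        simp only [hh', norm_mul, nexp, one_mul]
      rw [n1]
      refine (sq3 _ _ _).trans ?_
      rw [norm_neg, norm_mul, norm_mul, Complex.norm_I, mul_one, mul_pow, hσn, one_mul]
      have m1 : ‖d1 y + f3 y + l * f5 y‖ ^ 2 ≤ k₁⁻¹ * D y := by
        rw [inv_mul_eq_div, le_div_iff₀ hk1, ← (H1 y hy).deriv]
        linarith [(hDn y).1]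
      have m5 : ‖d5 y - l * f1 y‖ ^ 2 ≤ k₃⁻¹ * D y := by
        rw [inv_mul_eq_div, le_div_iff₀ hk3, ← (H5 y hy).deriv]
        linarith [(hDn y).2.2]
      have m3 : ‖f3 y‖ ^ 2 ≤ M3 ^ 2 :=
        pow_le_pow_left₀ (norm_nonneg _) (b3 y (Ioo_subset_Icc_self hy)) 2
      linarith
    · rw [intervalIntegral.integral_add (hDi.const_mul _) _root_.intervalIntegrable_const,
        intervalIntegral.integral_const_mul, intervalIntegral.integral_const]
      have : 3 * (k₁⁻¹ + k₃⁻¹) * ∫ x in (0 : ℝ)..L, D x ≤ 3 * (k₁⁻¹ + k₃⁻¹) * 1 :=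
        mul_le_mul_of_nonneg_left hE (by positivity)
      simp only [smul_eq_mul, hMz]
      linarith
  intro x hx
  have p := bz 1 (by norm_num) x hx
  have m := bz (-1) (by norm_num) x hx
  refine ⟨?_, ?_, ?_⟩
  · have e : f1 x = (1 / 2 : ℂ) * ((f1 x + (1 : ℝ) * Complex.I * f5 x) +
        (f1 x + (-1 : ℝ) * Complex.I * f5 x)) := by push_cast; ring
    rw [e, norm_mul]
    have := norm_add_le (f1 x + (1 : ℝ) * Complex.I * f5 x) (f1 x + (-1 : ℝ) * Complex.I * f5 x)
    have h2 : ‖(1 / 2 : ℂ)‖ = 1 / 2 := by norm_num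
    rw [h2]
    linarith
  · linarith [b3 x hx]
  · have e : f5 x = (-Complex.I / 2 : ℂ) * ((f1 x + (1 : ℝ) * Complex.I * f5 x) -
        (f1 x + (-1 : ℝ) * Complex.I * f5 x)) := by
      push_cast
      linear_combination (f5 x) * Complex.I_sq
    rw [e, norm_mul]
    have := norm_sub_le (f1 x + (1 : ℝ) * Complex.I * f5 x) (f1 x + (-1 : ℝ) * Complex.I * f5 x)
    have h2 : ‖(-Complex.I / 2 : ℂ)‖ = 1 / 2 := by simp
    rw [h2]
    linarith

lemma comp_le {L a b K : ℝ} (ha : 0 ≤ a) (hab : a ≤ b) (hb : b ≤ L) {D : ℝ → ℝ} {g : ℝ → ℂ}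
    (hK : 0 ≤ K) (hDi : IntervalIntegrable D volume 0 L) (hD0 : ∀ x, 0 ≤ D x)
    (hg : ContinuousOn g (Icc a b)) (hle : ∀ x ∈ Icc a b, ‖g x‖ ^ 2 ≤ K * D x) :
    ∫ x in a..b, ‖g x‖ ^ 2 ≤ K * ∫ x in (0 : ℝ)..L, D x := by
  rw [← intervalIntegral.integral_const_mul]
  have i2 := hDi.const_mul K
  refine le_trans (intervalIntegral.integral_mono_on hab (ii_sq hab hg) ?_ hle)
    (intervalIntegral.integral_mono_interval ha hab hb ?_ i2)
  · refine i2.mono_set ?_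
    rw [uIcc_of_le hab, uIcc_of_le (ha.trans (hab.trans hb))]
    exact Icc_subset_Icc ha hb
  · exact Eventually.of_forall fun x => mul_nonneg hK (hD0 x)

lemma v6_est {ρ₁ ρ₂ k₁ k₂ k₃ l L β a₀ : ℝ} {ℓ : ℕ}
    (hrho1 : 0 < ρ₁) (hrho2 : 0 < ρ₂) (hk1 : 0 < k₁) (hk2 : 0 < k₂) (hk3 : 0 < k₃)
    (hL : 0 < L) (hbeta : 0 < β) (hbetaL : β < L)
    (S : BresseSetting ρ₁ ρ₂ k₁ k₂ k₃ l L β a₀ ℓ) (n : ℕ) {s : ℝ} (hs : 0 < s) :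
    a₀ * ∫ x in (0 : ℝ)..β, ‖S.v6 n x‖ ^ 2 ≤ |(S.lam n) ^ (-(ℓ : ℤ))| * (s * 1 +
      (∫ x in (0 : ℝ)..L, dens ρ₁ ρ₂ k₁ k₂ k₃ l (deriv (S.f1 n)) (deriv (S.f3 n)) (deriv (S.f5 n))
        (S.f1 n) (S.f2 n) (S.f3 n) (S.f4 n) (S.f5 n) (S.f6 n) x) / s) := by
  have r1 : ContDiffOn ℝ 1 (S.v1 n) (Icc 0 L) := (S.reg_v1 n).of_le (by norm_num)
  have r3 : ContDiffOn ℝ 1 (S.v3 n) (Icc 0 L) := (S.reg_v3 n).of_le (by norm_num)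
  obtain ⟨d1, cd1, H1⟩ := ext_deriv hL r1
  obtain ⟨d3, cd3, H3⟩ := ext_deriv hL r3
  obtain ⟨d5, cd5, H5⟩ := ext_deriv hL (S.reg_v5 n)
  obtain ⟨e1, ce1, E1⟩ := ext_deriv hL (S.reg_f1 n)
  obtain ⟨e3, ce3, E3⟩ := ext_deriv hL (S.reg_f3 n)
  obtain ⟨e5, ce5, E5⟩ := ext_deriv hL (S.reg_f5 n)
  have cv1 := r1.continuousOn
  have cv3 := r3.continuousOn
  have cv5 := (S.reg_v5 n).continuousOn
  have cv2 := (S.reg_v2 n).continuousOn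
  have cv4 := (S.reg_v4 n).continuousOn
  have cv6 := (S.reg_v6 n).continuousOn
  have cf1 := (S.reg_f1 n).continuousOn
  have cf3 := (S.reg_f3 n).continuousOn
  have cf5 := (S.reg_f5 n).continuousOn
  have cf2 := S.reg_f2 n
  have cf4 := S.reg_f4 n
  have cf6 := S.reg_f6 n
  set c : ℝ := (S.lam n) ^ (-(ℓ : ℤ)) with hc
  have hcc : (S.lam n : ℂ) ^ (-(ℓ : ℤ)) = (c : ℂ) := by rw [hc]; push_cast; rfl
  have hU : ∀ x ∈ Ioo 0 β ∪ Ioo β L, x ∈ Ioo 0 L := by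
    rintro x (hx | hx)
    · exact ⟨hx.1, hx.2.trans hbetaL⟩
    · exact ⟨hbeta.trans hx.1, hx.2⟩
  have oU : IsOpen (Ioo 0 β ∪ Ioo β L) := isOpen_Ioo.union isOpen_Ioo
  have D1 : ∀ x ∈ Ioo 0 L, d1 x = deriv (S.v1 n) x := fun x hx => (H1 x hx).deriv.symm
  have D3 : ∀ x ∈ Ioo 0 L, d3 x = deriv (S.v3 n) x := fun x hx => (H3 x hx).deriv.symm
  have D5 : ∀ x ∈ Ioo 0 L, d5 x = deriv (S.v5 n) x := fun x hx => (H5 x hx).deriv.symm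
  have DD5 : ∀ x ∈ Ioo 0 β ∪ Ioo β L, DifferentiableAt ℝ (deriv (S.v5 n)) x := by
    rintro x (hx | hx)
    · exact ((cd_deriv_two (S.reg_v5_left n)).2 x hx).differentiableAt
    · exact ((cd_deriv_two (S.reg_v5_right n)).2 x hx).differentiableAt
  have DD1 : ∀ x ∈ Ioo 0 L, DifferentiableAt ℝ (deriv (S.v1 n)) x := fun x hx =>
    ((cd_deriv_two (S.reg_v1 n)).2 x hx).differentiableAt
  obtain ⟨-, b2, -, b4, -, b6, -⟩ := S.bc_zero n
  obtain ⟨-, B2, -, B4, -, B6, -⟩ := S.bc_L n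
  have en := energy (ρ₁ := ρ₁) (ρ₂ := ρ₂) (k₁ := k₁) (k₂ := k₂) (k₃ := k₃) (l := l)
    (lam := S.lam n) (c := c) (a₀ := a₀)
    (t1 := deriv (fun y => deriv (S.v1 n) y + S.v3 n y + (l : ℂ) * S.v5 n y))
    (t3 := deriv (deriv (S.v3 n)))
    (t5 := deriv (fun y => deriv (S.v5 n) y - (l : ℂ) * S.v1 n y))
    hbeta hbetaL cd1 cd3 cd5 cv1 cv2 cv3 cv4 cv5 cv6 ce1 ce3 ce5 cf1 cf2 cf3 cf4 cf5 cf6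
    b2 b4 b6 B2 B4 B6 ?_ ?_ ?_ ?_ ?_ ?_ ?_ ?_ ?_ ?_ ?_ ?_
  · rw [en]
    set R := rhs ρ₁ ρ₂ k₁ k₂ k₃ l d1 d3 d5 (S.v1 n) (S.v2 n) (S.v3 n) (S.v4 n) (S.v5 n) (S.v6 n)
      e1 e3 e5 (S.f1 n) (S.f2 n) (S.f3 n) (S.f4 n) (S.f5 n) (S.f6 n) with hR
    set DU := dens ρ₁ ρ₂ k₁ k₂ k₃ l (deriv (S.v1 n)) (deriv (S.v3 n)) (deriv (S.v5 n))
        (S.v1 n) (S.v2 n) (S.v3 n) (S.v4 n) (S.v5 n) (S.v6 n) with hDU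
    set DF := dens ρ₁ ρ₂ k₁ k₂ k₃ l (deriv (S.f1 n)) (deriv (S.f3 n)) (deriv (S.f5 n))
        (S.f1 n) (S.f2 n) (S.f3 n) (S.f4 n) (S.f5 n) (S.f6 n) with hDF
    have iU : IntervalIntegrable DU volume 0 L :=
      dens_ii ρ₁ ρ₂ k₁ k₂ k₃ l hL r1 r3 (S.reg_v5 n) cv2 cv4 cv6
    have iF : IntervalIntegrable DF volume 0 L :=
      dens_ii ρ₁ ρ₂ k₁ k₂ k₃ l hL (S.reg_f1 n) (S.reg_f3 n) (S.reg_f5 n) cf2 cf4 cf6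
    have hRle : ∀ x ∈ Ioo 0 L, ‖R x‖ ≤ s * DU x + DF x / s := by
      intro x hx
      have := rhs_le (l := l) hrho1 hrho2 hk1 hk2 hk3 d1 d3 d5 (S.v1 n) (S.v2 n) (S.v3 n) (S.v4 n)
        (S.v5 n) (S.v6 n) e1 e3 e5 (S.f1 n) (S.f2 n) (S.f3 n) (S.f4 n) (S.f5 n) (S.f6 n) x hs
      rw [Real.norm_eq_abs]
      refine this.trans (le_of_eq ?_)
      simp only [hDU, hDF, dens, D1 x hx, D3 x hx, D5 x hx, (E1 x hx).deriv, (E3 x hx).deriv,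
        (E5 x hx).deriv]
    have hintg : ‖∫ x in (0 : ℝ)..L, R x‖ ≤ ∫ x in (0 : ℝ)..L, (s * DU x + DF x / s) := by
      apply intervalIntegral.norm_integral_le_of_norm_le hL.le
      · have : ∀ᵐ x : ℝ, x ≠ L := by
          simp [ae_iff, measure_singleton]
        filter_upwards [this] with x hx hx2
        exact hRle x ⟨hx2.1, lt_of_le_of_ne hx2.2 hx⟩
      · exact (iU.const_mul s).add (iF.div_const s)
    rw [intervalIntegral.integral_add (iU.const_mul s) (iF.div_const s),
      intervalIntegral.integral_const_mul, intervalIntegral.integral_div] at hintg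
    have hU1 : ∫ x in (0 : ℝ)..L, DU x = 1 := S.normU n
    rw [hU1] at hintg
    calc c * ∫ x in (0 : ℝ)..L, R x ≤ |c * ∫ x in (0 : ℝ)..L, R x| := le_abs_self _
      _ = |c| * ‖∫ x in (0 : ℝ)..L, R x‖ := by rw [abs_mul, Real.norm_eq_abs]
      _ ≤ _ := mul_le_mul_of_nonneg_left hintg (abs_nonneg _)
  · intro x hx
    have hd : DifferentiableAt ℝ (fun y => deriv (S.v1 n) y + S.v3 n y + (l : ℂ) * S.v5 n y) x :=
      ((DD1 x (hU x hx)).add (H3 x (hU x hx)).differentiableAt).add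
        ((H5 x (hU x hx)).differentiableAt.const_mul _)
    refine hd.hasDerivAt.congr_of_eventuallyEq ?_
    filter_upwards [isOpen_Ioo.mem_nhds (hU x hx)] with y hy
    rw [D1 y hy]
  · intro x hx
    refine ((cd_deriv_two (S.reg_v3 n)).2 x (hU x hx)).congr_of_eventuallyEq ?_
    filter_upwards [isOpen_Ioo.mem_nhds (hU x hx)] with y hy
    rw [D3 y hy]
  · intro x hx
    have hd : DifferentiableAt ℝ (fun y => deriv (S.v5 n) y - (l : ℂ) * S.v1 n y) x :=
      (DD5 x hx).sub ((H1 x (hU x hx)).differentiableAt.const_mul _)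
    refine hd.hasDerivAt.congr_of_eventuallyEq ?_
    filter_upwards [isOpen_Ioo.mem_nhds (hU x hx)] with y hy
    rw [D5 y hy]
  · intro x hx
    refine (((H1 x (hU x hx)).const_mul (Complex.I * (S.lam n : ℂ))).sub
      ((E1 x (hU x hx)).const_mul (c : ℂ))).congr_of_eventuallyEq ?_
    filter_upwards [oU.mem_nhds hx] with y hy
    have := S.eq1 n y hy
    rw [hcc] at this
    simp only [Pi.sub_apply]
    linear_combination -this
  · intro x hx
    refine (((H3 x (hU x hx)).const_mul (Complex.I * (S.lam n : ℂ))).sub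
      ((E3 x (hU x hx)).const_mul (c : ℂ))).congr_of_eventuallyEq ?_
    filter_upwards [oU.mem_nhds hx] with y hy
    have := S.eq3 n y hy
    rw [hcc] at this
    simp only [Pi.sub_apply]
    linear_combination -this
  · intro x hx
    refine (((H5 x (hU x hx)).const_mul (Complex.I * (S.lam n : ℂ))).sub
      ((E5 x (hU x hx)).const_mul (c : ℂ))).congr_of_eventuallyEq ?_
    filter_upwards [oU.mem_nhds hx] with y hy
    have := S.eq5 n y hy
    rw [hcc] at this
    simp only [Pi.sub_apply]
    linear_combination -this
  · intro x hx
    rw [← hcc]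
    exact S.eq1 n x hx
  · intro x hx
    rw [← hcc, D5 x (hU x hx)]
    exact S.eq2 n x hx
  · intro x hx
    rw [← hcc]
    exact S.eq3 n x hx
  · intro x hx
    rw [← hcc, D1 x (hU x hx)]
    exact S.eq4 n x hx
  · intro x hx
    rw [← hcc]
    exact S.eq5 n x hx
  · intro x hx
    rw [← hcc, D1 x (hU x hx)]
    exact S.eq6 n x hx

lemma comp_parts {ρ₁ ρ₂ k₁ k₂ k₃ l : ℝ} (hrho1 : 0 < ρ₁) (hrho2 : 0 < ρ₂) (hk1 : 0 < k₁)
    (hk2 : 0 < k₂) (hk3 : 0 < k₃) (d1 d3 d5 v1 v2 v3 v4 v5 v6 : ℝ → ℂ) (x : ℝ) :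
    ‖d1 x + v3 x + (l : ℂ) * v5 x‖ ^ 2 ≤ k₁⁻¹ * dens ρ₁ ρ₂ k₁ k₂ k₃ l d1 d3 d5 v1 v2 v3 v4 v5 v6 x ∧
    ‖v2 x‖ ^ 2 ≤ ρ₁⁻¹ * dens ρ₁ ρ₂ k₁ k₂ k₃ l d1 d3 d5 v1 v2 v3 v4 v5 v6 x ∧
    ‖d3 x‖ ^ 2 ≤ k₂⁻¹ * dens ρ₁ ρ₂ k₁ k₂ k₃ l d1 d3 d5 v1 v2 v3 v4 v5 v6 x ∧
    ‖v4 x‖ ^ 2 ≤ ρ₂⁻¹ * dens ρ₁ ρ₂ k₁ k₂ k₃ l d1 d3 d5 v1 v2 v3 v4 v5 v6 x ∧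
    ‖d5 x - (l : ℂ) * v1 x‖ ^ 2 ≤ k₃⁻¹ * dens ρ₁ ρ₂ k₁ k₂ k₃ l d1 d3 d5 v1 v2 v3 v4 v5 v6 x ∧
    ‖v6 x‖ ^ 2 ≤ ρ₁⁻¹ * dens ρ₁ ρ₂ k₁ k₂ k₃ l d1 d3 d5 v1 v2 v3 v4 v5 v6 x := by
  unfold dens
  have p1 : 0 ≤ k₁ * ‖d1 x + v3 x + (l : ℂ) * v5 x‖ ^ 2 := by positivity
  have p2 : 0 ≤ ρ₁ * ‖v2 x‖ ^ 2 := by positivity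
  have p3 : 0 ≤ k₂ * ‖d3 x‖ ^ 2 := by positivity
  have p4 : 0 ≤ ρ₂ * ‖v4 x‖ ^ 2 := by positivity
  have p5 : 0 ≤ k₃ * ‖d5 x - (l : ℂ) * v1 x‖ ^ 2 := by positivity
  have p6 : 0 ≤ ρ₁ * ‖v6 x‖ ^ 2 := by positivity
  refine ⟨?_, ?_, ?_, ?_, ?_, ?_⟩
  · rw [inv_mul_eq_div, le_div_iff₀ hk1]; linarith
  · rw [inv_mul_eq_div, le_div_iff₀ hrho1]; linarith
  · rw [inv_mul_eq_div, le_div_iff₀ hk2]; linarith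
  · rw [inv_mul_eq_div, le_div_iff₀ hrho2]; linarith
  · rw [inv_mul_eq_div, le_div_iff₀ hk3]; linarith
  · rw [inv_mul_eq_div, le_div_iff₀ hrho1]; linarith

lemma comp_bd {ρ₁ ρ₂ k₁ k₂ k₃ l L : ℝ} (hrho1 : 0 < ρ₁) (hrho2 : 0 < ρ₂) (hk1 : 0 < k₁)
    (hk2 : 0 < k₂) (hk3 : 0 < k₃) (hL : 0 < L) {v1 v2 v3 v4 v5 v6 : ℕ → ℝ → ℂ}
    (r1 : ∀ n, ContDiffOn ℝ 1 (v1 n) (Icc 0 L)) (r3 : ∀ n, ContDiffOn ℝ 1 (v3 n) (Icc 0 L))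
    (r5 : ∀ n, ContDiffOn ℝ 1 (v5 n) (Icc 0 L)) (r2 : ∀ n, ContinuousOn (v2 n) (Icc 0 L))
    (r4 : ∀ n, ContinuousOn (v4 n) (Icc 0 L)) (r6 : ∀ n, ContinuousOn (v6 n) (Icc 0 L))
    (hE : ∀ᶠ n in atTop, (∫ x in (0 : ℝ)..L, dens ρ₁ ρ₂ k₁ k₂ k₃ l (deriv (v1 n)) (deriv (v3 n))
      (deriv (v5 n)) (v1 n) (v2 n) (v3 n) (v4 n) (v5 n) (v6 n) x) ≤ 1)
    {a b : ℝ} (ha : 0 < a) (hab : a ≤ b) (hb : b < L) :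
    Bd a b (fun n x => deriv (v1 n) x + v3 n x + (l : ℂ) * v5 n x) ∧
    Bd a b v2 ∧ Bd a b (fun n => deriv (v3 n)) ∧ Bd a b v4 ∧
    Bd a b (fun n x => deriv (v5 n) x - (l : ℂ) * v1 n x) ∧ Bd a b v6 := by
  have hs : Icc a b ⊆ Icc 0 L := Icc_subset_Icc ha.le hb.le
  have hs' : Icc a b ⊆ Ioo 0 L := fun x hx => ⟨ha.trans_le hx.1, hx.2.trans_lt hb⟩
  have main : ∀ (g : ℕ → ℝ → ℂ) (K : ℝ), 0 < K → (∀ n, ContinuousOn (g n) (Icc a b)) →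
      (∀ n, ∀ x ∈ Icc a b, ‖g n x‖ ^ 2 ≤ K⁻¹ * dens ρ₁ ρ₂ k₁ k₂ k₃ l (deriv (v1 n)) (deriv (v3 n))
      (deriv (v5 n)) (v1 n) (v2 n) (v3 n) (v4 n) (v5 n) (v6 n) x) → Bd a b g := by
    intro g K hK hg hle
    refine ⟨hg, K⁻¹ * 1, ?_⟩
    filter_upwards [hE] with n hn
    refine (comp_le ha.le hab hb.le (by positivity)
      (dens_ii ρ₁ ρ₂ k₁ k₂ k₃ l hL (r1 n) (r3 n) (r5 n) (r2 n) (r4 n) (r6 n))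
      (fun x => dens_nonneg hrho1 hrho2 hk1 hk2 hk3 _ _ _ _ _ _ _ _ _ x) (hg n) (hle n)).trans ?_
    exact mul_le_mul_of_nonneg_left hn (by positivity)
  have parts := fun (n : ℕ) (x : ℝ) => comp_parts (l := l) hrho1 hrho2 hk1 hk2 hk3 (deriv (v1 n))
    (deriv (v3 n)) (deriv (v5 n)) (v1 n) (v2 n) (v3 n) (v4 n) (v5 n) (v6 n) x
  have c1 := fun n => (cd_deriv_one (r1 n)).1.mono hs'
  have c3 := fun n => (cd_deriv_one (r3 n)).1.mono hs'
  have c5 := fun n => (cd_deriv_one (r5 n)).1.mono hs'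
  refine ⟨main _ k₁ hk1 (fun n => ?_) fun n x _ => (parts n x).1,
    main _ ρ₁ hrho1 (fun n => (r2 n).mono hs) fun n x _ => (parts n x).2.1,
    main _ k₂ hk2 c3 fun n x _ => (parts n x).2.2.1,
    main _ ρ₂ hrho2 (fun n => (r4 n).mono hs) fun n x _ => (parts n x).2.2.2.1,
    main _ k₃ hk3 (fun n => ?_) fun n x _ => (parts n x).2.2.2.2.1,
    main _ ρ₁ hrho1 (fun n => (r6 n).mono hs) fun n x _ => (parts n x).2.2.2.2.2⟩
  · exact ((c1 n).add ((r3 n).continuousOn.mono hs)).add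
      (continuousOn_const.mul ((r5 n).continuousOn.mono hs))
  · exact (c5 n).sub (continuousOn_const.mul ((r1 n).continuousOn.mono hs))

lemma bd_of_sup {a b M : ℝ} (hab : a ≤ b) {g : ℕ → ℝ → ℂ}
    (hg : ∀ n, ContinuousOn (g n) (Icc a b))
    (h : ∀ᶠ n in atTop, ∀ x ∈ Icc a b, ‖g n x‖ ≤ M) : Bd a b g := by
  refine ⟨hg, ∫ _ in a..b, M ^ 2, ?_⟩
  filter_upwards [h] with n hn
  apply intervalIntegral.integral_mono_on hab (ii_sq hab (hg n)) _root_.intervalIntegrable_const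
  intro x hx
  exact pow_le_pow_left₀ (norm_nonneg _) (hn x hx) 2

lemma split_lim {p q κ : ℝ} (hpq : p ≤ q) (hκ : κ ≠ 0) {r : ℕ → ℝ → ℝ} {g S h : ℕ → ℝ → ℂ}
    (hg : ∀ n, ContinuousOn (g n) (Icc p q)) (hS : ∀ n, ContinuousOn (S n) (Icc p q))
    (hh : ∀ n, ContinuousOn (h n) (Icc p q))
    (hr : ∀ n, ∀ x ∈ Icc p q, r n x = κ * (g n x * (starRingEnd ℂ) (g n x)).re
      + (S n x * (starRingEnd ℂ) (h n x)).re)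
    (hX : Tendsto (fun n => ∫ x in p..q, eta p q x * r n x) atTop (nhds 0))
    (hY : Tendsto (fun n => ∫ x in p..q, eta p q x * (S n x * (starRingEnd ℂ) (h n x)).re)
      atTop (nhds 0)) :
    Tendsto (fun n => ∫ x in p..q, eta p q x * (g n x * (starRingEnd ℂ) (g n x)).re)
      atTop (nhds 0) := by
  have h1 := (hX.sub hY).const_mul κ⁻¹
  rw [sub_zero, mul_zero] at h1
  refine h1.congr fun n => ?_
  have ce := (eta_cont p q).continuousOn (s := Icc p q)
  have i1 := ii_of_cont hpq (cont_pair ce (hg n) (hg n))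
  have i2 := ii_of_cont hpq (cont_pair ce (hS n) (hh n))
  have : ∫ x in p..q, eta p q x * r n x =
      ∫ x in p..q, (κ * (eta p q x * (g n x * (starRingEnd ℂ) (g n x)).re)
        + eta p q x * (S n x * (starRingEnd ℂ) (h n x)).re) := by
    apply intervalIntegral.integral_congr
    intro x hx
    rw [uIcc_of_le hpq] at hx
    simp only [hr n x hx]
    ring
  rw [this, intervalIntegral.integral_add (i1.const_mul κ) i2,
    intervalIntegral.integral_const_mul]
  field_simp
  ring

theorem core (ρ₁ ρ₂ k₁ k₂ k₃ l L β a₀ : ℝ) (ℓ : ℕ)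
    (hrho1 : 0 < ρ₁) (hrho2 : 0 < ρ₂) (hk1 : 0 < k₁) (hk2 : 0 < k₂) (hk3 : 0 < k₃)
    (hl : 0 < l) (hL : 0 < L) (ha0 : 0 < a₀) (hbeta : 0 < β) (hbetaL : β < L)
    (S : BresseSetting ρ₁ ρ₂ k₁ k₂ k₃ l L β a₀ ℓ) (hℓ : 2 ≤ ℓ) (ε : ℝ) (hε : 0 < ε)
    (hεβ : ε < β / 12) :
    Sm (2 * ε) (β - 2 * ε) (fun n => deriv (S.v1 n)) ∧
    Sm (3 * ε) (β - 3 * ε) (fun n x => (S.lam n : ℂ) * S.v1 n x) := by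
  have r1 : ∀ n, ContDiffOn ℝ 1 (S.v1 n) (Icc 0 L) := fun n => (S.reg_v1 n).of_le (by norm_num)
  have r3 : ∀ n, ContDiffOn ℝ 1 (S.v3 n) (Icc 0 L) := fun n => (S.reg_v3 n).of_le (by norm_num)
  set a := ε / 2 with ha
  set b := β - ε / 2 with hb
  have ha0' : 0 < a := by positivity
  have hab : a ≤ b := by linarith
  have hbβ : b < β := by linarith
  have hbL : b < L := by linarith
  have hs : Icc a b ⊆ Icc 0 L := Icc_subset_Icc ha0'.le hbL.le
  have hsO : Icc a b ⊆ Ioo 0 L := fun x hx => ⟨ha0'.trans_le hx.1, hx.2.trans_lt hbL⟩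
  have hsβ : Icc a b ⊆ Ioo 0 β := fun x hx => ⟨ha0'.trans_le hx.1, hx.2.trans_lt hbβ⟩
  -- scalars
  set c : ℕ → ℝ := fun n => (S.lam n) ^ (-(ℓ : ℤ)) with hc
  have hcc : ∀ n, (S.lam n : ℂ) ^ (-(ℓ : ℤ)) = (c n : ℂ) := fun n => by
    simp only [hc]; push_cast; rfl
  have hlc : ∀ n, (S.lam n : ℂ) ≠ 0 := fun n => by exact_mod_cast S.lam_ne n
  have hlam1 : ∀ᶠ n in atTop, 1 ≤ |S.lam n| := S.lam_tendsto.eventually_ge_atTop 1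
  have hinv : Tendsto (fun n => |S.lam n|⁻¹) atTop (nhds 0) :=
    tendsto_inv_atTop_zero.comp S.lam_tendsto
  have hc2 : ∀ᶠ n in atTop, (S.lam n) ^ 2 * |c n| ≤ 1 := by
    filter_upwards [hlam1] with n hn
    have h0 : 0 < |S.lam n| := by linarith
    simp only [hc]
    rw [abs_zpow, zpow_neg, zpow_natCast, ← sq_abs, ← div_eq_mul_inv, div_le_one (by positivity)]
    exact pow_le_pow_right₀ hn hℓ
  have hlc0 : Tendsto (fun n => |S.lam n| * |c n|) atTop (nhds 0) := by
    refine squeeze_zero' (Eventually.of_forall fun n => by positivity) ?_ hinv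
    filter_upwards [hc2] with n hn
    have h0 : 0 < |S.lam n| := abs_pos.2 (S.lam_ne n)
    rw [← one_div, le_div_iff₀ h0]
    rw [← sq_abs] at hn
    linarith
  have hc0 : Tendsto (fun n => |c n|) atTop (nhds 0) := by
    refine squeeze_zero' (Eventually.of_forall fun n => by positivity) ?_ hlc0
    filter_upwards [hlam1] with n hn
    nlinarith [abs_nonneg (c n)]
  have zLinv : Tendsto (fun n => ‖(S.lam n : ℂ)⁻¹‖) atTop (nhds 0) :=
    hinv.congr fun n => by rw [norm_inv, Complex.norm_real, Real.norm_eq_abs]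
  have zC : Tendsto (fun n => ‖(c n : ℂ)‖) atTop (nhds 0) :=
    hc0.congr fun n => by rw [Complex.norm_real, Real.norm_eq_abs]
  have zLC : Tendsto (fun n => ‖(S.lam n : ℂ) * (c n : ℂ)‖) atTop (nhds 0) :=
    hlc0.congr fun n => by
      rw [norm_mul, Complex.norm_real, Complex.norm_real, Real.norm_eq_abs, Real.norm_eq_abs]
  -- bounds
  have hEF : Tendsto (fun n => ∫ x in (0 : ℝ)..L, dens ρ₁ ρ₂ k₁ k₂ k₃ l (deriv (S.f1 n))
      (deriv (S.f3 n)) (deriv (S.f5 n))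
      (S.f1 n) (S.f2 n) (S.f3 n) (S.f4 n) (S.f5 n) (S.f6 n) x) atTop (nhds 0) := S.normF
  have hEF1 := (hEF.eventually (gt_mem_nhds one_pos)).mono fun _ h => le_of_lt h
  obtain ⟨bT, b2, bd3, b4, bN, b6⟩ := comp_bd (l := l) hrho1 hrho2 hk1 hk2 hk3 hL r1 r3 S.reg_v5
    (fun n => (S.reg_v2 n).continuousOn) (fun n => (S.reg_v4 n).continuousOn)
    (fun n => (S.reg_v6 n).continuousOn) (Eventually.of_forall fun n => le_of_eq (S.normU n))
    ha0' hab hbL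
  obtain ⟨-, bf2, -, -, -, bf6⟩ := comp_bd (l := l) hrho1 hrho2 hk1 hk2 hk3 hL S.reg_f1 S.reg_f3
    S.reg_f5 S.reg_f2 S.reg_f4 S.reg_f6 hEF1 ha0' hab hbL
  obtain ⟨M, hM⟩ := F_sup (l := l) hrho1 hrho2 hk1 hk2 hk3 hL
  have hM' : ∀ᶠ n in atTop, ∀ x ∈ Icc a b, ‖S.f1 n x‖ ≤ M ∧ ‖S.f3 n x‖ ≤ M ∧ ‖S.f5 n x‖ ≤ M := by
    filter_upwards [hEF1] with n hn x hx
    obtain ⟨-, -, -, -, -, -, z1, z3, z5⟩ := S.bc_zero n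
    exact hM _ _ _ _ _ _ (S.reg_f1 n) (S.reg_f3 n) (S.reg_f5 n) (S.reg_f2 n) (S.reg_f4 n)
      (S.reg_f6 n) z1 z3 z5 hn x (hs hx)
  have bf1 : Bd a b S.f1 := bd_of_sup hab (fun n => (S.reg_f1 n).continuousOn.mono hs)
    (hM'.mono fun n h x hx => (h x hx).1)
  have bf3 : Bd a b S.f3 := bd_of_sup hab (fun n => (S.reg_f3 n).continuousOn.mono hs)
    (hM'.mono fun n h x hx => (h x hx).2.1)
  have bf5 : Bd a b S.f5 := bd_of_sup hab (fun n => (S.reg_f5 n).continuousOn.mono hs)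
    (hM'.mono fun n h x hx => (h x hx).2.2)
  -- smallness of lam * v6
  have sL6 : Sm a b (fun n x => (S.lam n : ℂ) * S.v6 n x) := by
    refine ⟨fun n => continuousOn_const.mul (b6.1 n), ?_⟩
    have hK := hEF.const_mul a₀⁻¹
    rw [mul_zero] at hK
    refine tendsto_zero_of_s (C := a₀⁻¹) (fun n => int_nonneg hab _) hK fun s hs' => ?_
    filter_upwards [hc2] with n hn
    rw [int_smul, Complex.norm_real, Real.norm_eq_abs, sq_abs]
    have h1 := v6_est hrho1 hrho2 hk1 hk2 hk3 hL hbeta hbetaL S n hs'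
    set EF := ∫ x in (0 : ℝ)..L, dens ρ₁ ρ₂ k₁ k₂ k₃ l (deriv (S.f1 n))
      (deriv (S.f3 n)) (deriv (S.f5 n))
      (S.f1 n) (S.f2 n) (S.f3 n) (S.f4 n) (S.f5 n) (S.f6 n) x with hEFd
    have hEF0 : 0 ≤ EF := intervalIntegral.integral_nonneg hL.le fun x _ =>
      dens_nonneg hrho1 hrho2 hk1 hk2 hk3 _ _ _ _ _ _ _ _ _ x
    have h2 : ∫ x in a..b, ‖S.v6 n x‖ ^ 2 ≤ ∫ x in (0 : ℝ)..β, ‖S.v6 n x‖ ^ 2 :=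
      int_mono ha0'.le hab hbβ.le
        ((S.reg_v6 n).continuousOn.mono (Icc_subset_Icc le_rfl hbetaL.le))
    have h3 : 0 ≤ s * 1 + EF / s := by positivity
    have h4 : ∫ x in (0 : ℝ)..β, ‖S.v6 n x‖ ^ 2 ≤ a₀⁻¹ * (|c n| * (s * 1 + EF / s)) := by
      rw [inv_mul_eq_div, le_div_iff₀ ha0]
      linarith
    calc S.lam n ^ 2 * ∫ x in a..b, ‖S.v6 n x‖ ^ 2
        ≤ S.lam n ^ 2 * (a₀⁻¹ * (|c n| * (s * 1 + EF / s))) :=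
          mul_le_mul_of_nonneg_left (h2.trans h4) (sq_nonneg _)
      _ = (S.lam n ^ 2 * |c n|) * (a₀⁻¹ * (s * 1 + EF / s)) := by ring
      _ ≤ 1 * (a₀⁻¹ * (s * 1 + EF / s)) :=
          mul_le_mul_of_nonneg_right hn (by positivity)
      _ = s * a₀⁻¹ + a₀⁻¹ * EF / s := by ring
  have hI := Complex.I_sq
  have E1 : ∀ n, ∀ x ∈ Icc a b, (S.lam n : ℂ) * S.v1 n x
      = -Complex.I * (S.v2 n x + (c n : ℂ) * S.f1 n x) := by
    intro n x hx
    have := S.eq1 n x (Or.inl (hsβ hx))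
    rw [hcc] at this
    linear_combination (-Complex.I) * this + (S.lam n * S.v1 n x) * hI
  have E3 : ∀ n, ∀ x ∈ Icc a b, (S.lam n : ℂ) * S.v3 n x
      = -Complex.I * (S.v4 n x + (c n : ℂ) * S.f3 n x) := by
    intro n x hx
    have := S.eq3 n x (Or.inl (hsβ hx))
    rw [hcc] at this
    linear_combination (-Complex.I) * this + (S.lam n * S.v3 n x) * hI
  have E5 : ∀ n, ∀ x ∈ Icc a b, (S.lam n : ℂ) * S.v5 n x
      = -Complex.I * (S.v6 n x + (c n : ℂ) * S.f5 n x) := by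
    intro n x hx
    have := S.eq5 n x (Or.inl (hsβ hx))
    rw [hcc] at this
    linear_combination (-Complex.I) * this + (S.lam n * S.v5 n x) * hI
  have bL1 : Bd a b (fun n x => (S.lam n : ℂ) * S.v1 n x) :=
    ((b2.add hab (bf1.smul_zero hab zC).bd).cmul hab (-Complex.I)).congr hab E1
  have bL3 : Bd a b (fun n x => (S.lam n : ℂ) * S.v3 n x) :=
    ((b4.add hab (bf3.smul_zero hab zC).bd).cmul hab (-Complex.I)).congr hab E3
  have s1 : Sm a b S.v1 := (bL1.smul_zero hab zLinv).congr hab fun n x _ => by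
    rw [inv_mul_cancel_left₀ (hlc n)]
  have s3 : Sm a b S.v3 := (bL3.smul_zero hab zLinv).congr hab fun n x _ => by
    rw [inv_mul_cancel_left₀ (hlc n)]
  have sLL5 : Sm a b (fun n x => (S.lam n : ℂ) ^ 2 * S.v5 n x) := by
    refine ((sL6.add hab (bf5.smul_zero hab zLC)).cmul hab (-Complex.I)).congr hab fun n x hx => ?_
    linear_combination (S.lam n : ℂ) * E5 n x hx
  have s5 : Sm a b S.v5 := by
    have z2 : Tendsto (fun n => ‖((S.lam n : ℂ) ^ 2)⁻¹‖) atTop (nhds 0) := by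
      have := zLinv.pow 2
      rw [zero_pow two_ne_zero] at this
      exact this.congr fun n => by rw [← norm_pow, inv_pow]
    refine (sLL5.bd.smul_zero hab z2).congr hab fun n x _ => ?_
    rw [inv_mul_cancel_left₀ (pow_ne_zero 2 (hlc n))]
  have s6 : Sm a b S.v6 := (sL6.bd.smul_zero hab zLinv).congr hab fun n x _ => by
    rw [inv_mul_cancel_left₀ (hlc n)]
  have bd1 : Bd a b (fun n => deriv (S.v1 n)) :=
    ((bT.add hab (s3.cmul hab (-1)).bd).add hab (s5.cmul hab (-l)).bd).congr hab
      fun n x _ => by ring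
  have bd5 : Bd a b (fun n => deriv (S.v5 n)) :=
    (bN.add hab (s1.cmul hab l).bd).congr hab fun n x _ => by ring
  -- derivatives
  have D1 : ∀ n, ∀ x ∈ Icc a b, HasDerivAt (S.v1 n) (deriv (S.v1 n) x) x := fun n x hx =>
    (cd_deriv_one (r1 n)).2 x (hsO hx)
  have D3 : ∀ n, ∀ x ∈ Icc a b, HasDerivAt (S.v3 n) (deriv (S.v3 n) x) x := fun n x hx =>
    (cd_deriv_one (r3 n)).2 x (hsO hx)
  have D5 : ∀ n, ∀ x ∈ Icc a b, HasDerivAt (S.v5 n) (deriv (S.v5 n) x) x := fun n x hx =>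
    (cd_deriv_one (S.reg_v5 n)).2 x (hsO hx)
  have DD1 : ∀ n, ∀ x ∈ Icc a b, HasDerivAt (deriv (S.v1 n)) (deriv (deriv (S.v1 n)) x) x :=
    fun n x hx => (cd_deriv_two (S.reg_v1 n)).2 x (hsO hx)
  have DD5 : ∀ n, ∀ x ∈ Icc a b, HasDerivAt (deriv (S.v5 n)) (deriv (deriv (S.v5 n)) x) x :=
    fun n x hx => (cd_deriv_two (S.reg_v5_left n)).2 x (hsβ hx)
  have hk1c : (k₁ : ℂ) ≠ 0 := by exact_mod_cast hk1.ne'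
  have hk3c : (k₃ : ℂ) ≠ 0 := by exact_mod_cast hk3.ne'
  have E6 : ∀ n, ∀ x ∈ Icc a b, (k₃ : ℂ) * deriv (deriv (S.v5 n)) x =
      (l * (k₁ + k₃)) * deriv (S.v1 n) x + (l * k₁ * S.v3 n x + l ^ 2 * k₁ * S.v5 n x
      + Complex.I * ρ₁ * (S.lam n * S.v6 n x) + a₀ * S.v6 n x
      + (-ρ₁) * (c n * S.f6 n x)) := by
    intro n x hx
    have := S.eq6 n x (Or.inl (hsβ hx))
    have hd : deriv (fun y => deriv (S.v5 n) y - (l : ℂ) * S.v1 n y) x =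
        deriv (deriv (S.v5 n)) x - (l : ℂ) * deriv (S.v1 n) x :=
      ((DD5 n x hx).sub ((D1 n x hx).const_mul (l : ℂ))).deriv
    rw [hcc, hd, if_pos (hsβ hx).2] at this
    linear_combination -this
  have E2 : ∀ n, ∀ x ∈ Icc a b, (k₁ : ℂ) * deriv (deriv (S.v1 n)) x =
      Complex.I * ρ₁ * (S.lam n * S.v2 n x) + ((-k₁) * deriv (S.v3 n) x
      + (-(l * k₁)) * deriv (S.v5 n) x + (-(l * k₃)) * (deriv (S.v5 n) x - l * S.v1 n x)
      + (-ρ₁) * (c n * S.f2 n x)) := by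
    intro n x hx
    have := S.eq2 n x (Or.inl (hsβ hx))
    have hd : deriv (fun y => deriv (S.v1 n) y + S.v3 n y + (l : ℂ) * S.v5 n y) x =
        deriv (deriv (S.v1 n)) x + deriv (S.v3 n) x + (l : ℂ) * deriv (S.v5 n) x :=
      (((DD1 n x hx).add (D3 n x hx)).add ((D5 n x hx).const_mul (l : ℂ))).deriv
    rw [hcc, hd] at this
    linear_combination -this
  -- the remainder in eq6
  have sR6 : Sm a b (fun n x => (l : ℂ) * k₁ * S.v3 n x + (l : ℂ) ^ 2 * k₁ * S.v5 n x
      + Complex.I * ρ₁ * (S.lam n * S.v6 n x) + a₀ * S.v6 n x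
      + (-ρ₁) * (c n * S.f6 n x)) :=
    ((((s3.cmul hab (l * k₁)).add hab (s5.cmul hab (l ^ 2 * k₁))).add hab
      (sL6.cmul hab (Complex.I * ρ₁))).add hab (s6.cmul hab a₀)).add hab
      ((bf6.smul_zero hab zC).cmul hab (-ρ₁))
  have bdd5 : Bd a b (fun n => deriv (deriv (S.v5 n))) := by
    refine (((bd1.cmul hab (l * (k₁ + k₃))).add hab sR6.bd).cmul hab (k₃ : ℂ)⁻¹).congr hab
      fun n x hx => ?_
    rw [← E6 n x hx, inv_mul_cancel_left₀ hk3c]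
  have bR2 : Bd a b (fun n x => ((-k₁ : ℂ)) * deriv (S.v3 n) x
      + (-(l * k₁)) * deriv (S.v5 n) x + (-(l * k₃)) * (deriv (S.v5 n) x - l * S.v1 n x)
      + (-ρ₁) * (c n * S.f2 n x)) :=
    (((bd3.cmul hab (-k₁)).add hab (bd5.cmul hab (-(l * k₁)))).add hab
      (bN.cmul hab (-(l * k₃)))).add hab ((bf2.smul_zero hab zC).bd.cmul hab (-ρ₁))
  have bdd1 : Bd a b (fun n x => (S.lam n : ℂ)⁻¹ * deriv (deriv (S.v1 n)) x) := by
    refine (((b2.cmul hab (Complex.I * ρ₁)).add hab (bR2.smul_zero hab zLinv).bd).cmul hab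
      (k₁ : ℂ)⁻¹).congr hab fun n x hx => ?_
    have e := E2 n x hx
    have h1 := hlc n
    field_simp
    linear_combination e
  have cdd1 : ∀ n, ContinuousOn (deriv (deriv (S.v1 n))) (Icc a b) := fun n =>
    (cd_deriv_two (S.reg_v1 n)).1.mono hsO
  -- Step 5
  have sL5' : Sm ε (β - ε) (fun n x => (S.lam n : ℂ) * deriv (S.v5 n) x) := by
    have key := key_ibp hab DD5 (w := fun n x => (S.lam n : ℂ) ^ 2 * S.v5 n x)
      (w' := fun n x => (S.lam n : ℂ) ^ 2 * deriv (S.v5 n) x)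
      (fun n x hx => (D5 n x hx).const_mul _) bdd5.1
      (fun n => continuousOn_const.mul (bd5.1 n)) bd5 sLL5
    have key2 := key.sub (pair hab (eta_cont a b).continuousOn bdd5 sLL5)
    rw [sub_zero] at key2
    have := loc (g := fun n x => (S.lam n : ℂ) * deriv (S.v5 n) x) (p := a) (q := b) (e := ε / 2)
      (by positivity) (by linarith) (fun n => continuousOn_const.mul (bd5.1 n)) (by
        refine key2.congr fun n => ?_
        rw [add_sub_cancel_left]
        congr 1
        ext x
        simp only [map_mul, map_pow, Complex.conj_ofReal]
        congr 2
        ring)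
    exact this.mono (by linarith) (by linarith) (by linarith)
  -- Step 7
  have s1' : Sm (2 * ε) (β - 2 * ε) (fun n => deriv (S.v1 n)) := by
    have hpq : ε ≤ β - ε := by linarith
    have hap : a ≤ ε := by linarith
    have hqb : β - ε ≤ b := by linarith
    have hsub : Icc ε (β - ε) ⊆ Icc a b := Icc_subset_Icc hap hqb
    have bw := bd1.mono hap hpq hqb
    have key := key_ibp hpq (u := fun n x => (S.lam n : ℂ) * deriv (S.v5 n) x)
      (u' := fun n x => (S.lam n : ℂ) * deriv (deriv (S.v5 n)) x)
      (w := fun n x => (S.lam n : ℂ)⁻¹ * deriv (S.v1 n) x)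
      (w' := fun n x => (S.lam n : ℂ)⁻¹ * deriv (deriv (S.v1 n)) x)
      (fun n x hx => (DD5 n x (hsub hx)).const_mul _)
      (fun n x hx => (DD1 n x (hsub hx)).const_mul _)
      (fun n => continuousOn_const.mul ((bdd5.1 n).mono hsub))
      (fun n => continuousOn_const.mul ((cdd1 n).mono hsub)) sL5'.bd (bw.smul_zero hpq zLinv)
    have key2 := key.sub (pair' hpq (eta_cont ε (β - ε)).continuousOn
      (bdd1.mono hap hpq hqb) sL5')
    rw [sub_zero] at key2
    simp only [add_sub_cancel_right] at key2
    have sR := (sR6.cmul hab (k₃ : ℂ)⁻¹).mono hap hpq hqb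
    have := loc (g := fun n => deriv (S.v1 n)) (p := ε) (q := β - ε) (e := ε)
      hε (by linarith) bw.1 (split_lim hpq (κ := k₃⁻¹ * (l * (k₁ + k₃))) (by positivity) bw.1
        sR.1 bw.1 ?_ key2 (pair' hpq (eta_cont ε (β - ε)).continuousOn bw sR))
    · exact this.mono (by linarith) (by linarith) (by linarith)
    · intro n x hx
      have e : deriv (deriv (S.v5 n)) x = (k₃ : ℂ)⁻¹ * ((k₃ : ℂ) * deriv (deriv (S.v5 n)) x) := by
        rw [inv_mul_cancel_left₀ hk3c]
      have h1 := hlc n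
      have e2 : (S.lam n : ℂ) * deriv (deriv (S.v5 n)) x *
          (starRingEnd ℂ) ((S.lam n : ℂ)⁻¹ * deriv (S.v1 n) x) =
          deriv (deriv (S.v5 n)) x * (starRingEnd ℂ) (deriv (S.v1 n) x) := by
        rw [map_mul, map_inv₀, Complex.conj_ofReal]
        field_simp
      rw [e2, e, E6 n x (hsub hx), ← Complex.re_ofReal_mul, ← Complex.add_re]
      congr 1
      push_cast
      ring
  refine ⟨s1', ?_⟩
  -- Step 8
  have hpq : 2 * ε ≤ β - 2 * ε := by linarith
  have hap : a ≤ 2 * ε := by linarith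
  have hqb : β - 2 * ε ≤ b := by linarith
  have hsub : Icc (2 * ε) (β - 2 * ε) ⊆ Icc a b := Icc_subset_Icc hap hqb
  have sw := s1.mono hap hpq hqb
  have key := key_ibp hpq (u := fun n => deriv (S.v1 n)) (w := S.v1)
    (fun n x hx => DD1 n x (hsub hx)) (fun n x hx => D1 n x (hsub hx))
    (fun n => (cdd1 n).mono hsub) (fun n => (bd1.1 n).mono hsub) s1'.bd sw
  have key2 := key.sub (pair hpq (eta_cont (2 * ε) (β - 2 * ε)).continuousOn s1'.bd s1')
  rw [sub_zero] at key2
  simp only [add_sub_cancel_right] at key2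
  have bR := ((bR2.add hab ((bf1.smul_zero hab zLC).bd.cmul hab (-Complex.I * ρ₁))).cmul hab
    (k₁ : ℂ)⁻¹).mono hap hpq hqb
  have cL : ∀ n, ContinuousOn (fun x => (S.lam n : ℂ) * S.v1 n x) (Icc (2 * ε) (β - 2 * ε)) :=
    fun n => continuousOn_const.mul (sw.1 n)
  have := loc (g := fun n x => (S.lam n : ℂ) * S.v1 n x) (p := 2 * ε) (q := β - 2 * ε) (e := ε)
    hε (by linarith) cL (split_lim hpq (κ := -(k₁⁻¹ * ρ₁)) (neg_ne_zero.2 (by positivity)) cL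
      bR.1 sw.1 ?_ key2 (pair hpq (eta_cont (2 * ε) (β - 2 * ε)).continuousOn bR sw))
  · exact this.mono (by linarith) (by linarith) (by linarith)
  · intro n x hx
    have e : deriv (deriv (S.v1 n)) x = (k₁ : ℂ)⁻¹ * ((k₁ : ℂ) * deriv (deriv (S.v1 n)) x) := by
      rw [inv_mul_cancel_left₀ hk1c]
    have e1 := S.eq1 n x (Or.inl (hsβ (hsub hx)))
    rw [hcc] at e1
    rw [e, E2 n x (hsub hx), ← Complex.re_ofReal_mul, ← Complex.add_re]
    congr 1
    rw [map_mul, Complex.conj_ofReal]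
    push_cast
    linear_combination (-(k₁ : ℂ)⁻¹ * Complex.I * ρ₁ * S.lam n * (starRingEnd ℂ) (S.v1 n x)) * e1
      + ((k₁ : ℂ)⁻¹ * ρ₁ * S.lam n ^ 2 * S.v1 n x * (starRingEnd ℂ) (S.v1 n x)) * hI

theorem bresse_lemma3_estimates (ρ₁ ρ₂ k₁ k₂ k₃ l L β a₀ : ℝ) (ℓ : ℕ)
    (hrho1 : 0 < ρ₁) (hrho2 : 0 < ρ₂) (hk1 : 0 < k₁) (hk2 : 0 < k₂) (hk3 : 0 < k₃)
    (hl : 0 < l) (hL : 0 < L) (ha0 : 0 < a₀) (hbeta : 0 < β) (hbetaL : β < L)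
    (S : BresseSetting ρ₁ ρ₂ k₁ k₂ k₃ l L β a₀ ℓ)
    (hH : (k₁ / ρ₁ = k₂ / ρ₂ ∧ k₁ ≠ k₃ ∧ ℓ = 2) ∨ (k₁ / ρ₁ ≠ k₂ / ρ₂ ∧ ℓ = 4)) :
    ∀ ε : ℝ, 0 < ε → ε < β / 12 →
    Tendsto (fun n => ∫ x in (2 * ε)..(β - 2 * ε), ‖deriv (S.v1 n) x‖ ^ 2) atTop (nhds 0) ∧
    Tendsto (fun n => (S.lam n) ^ 2 * ∫ x in (3 * ε)..(β - 3 * ε), ‖S.v1 n x‖ ^ 2)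
      atTop (nhds 0) := by
  intro ε hε hεβ
  have hℓ : 2 ≤ ℓ := by
    rcases hH with ⟨-, -, h⟩ | ⟨-, h⟩ <;> omega
  obtain ⟨h1, h2⟩ := core ρ₁ ρ₂ k₁ k₂ k₃ l L β a₀ ℓ hrho1 hrho2 hk1 hk2 hk3 hl hL ha0 hbeta hbetaL
    S hℓ ε hε hεβ
  refine ⟨h1.2, h2.2.congr fun n => ?_⟩
  rw [int_smul, Complex.norm_real, Real.norm_eq_abs, sq_abs]
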